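/- arXiv:math/0609364 — 5 statements merged into one kernel-verified Lean document; each statement's English description precedes it below -/
import Mathlib

section
/- Let I be a connected component of ℝ∖A and let μ|_I be the restriction of μ to the Borel subsets of I. If I∖K is nonempty, then μ|_I vanishes identically. If I is bounded and μ|_I does not vanish identically, then μ|_I is absolutely continuous with respect to Lebesgue measure with a density of rational beta type on I. -/
open MeasureTheory Filter Topology
open scoped Classical

noncomputable section

/-- The (closed) support of a measure on `ℝ`: the set of points all of whose
open neighborhoods have positive measure. -/
def measSupport (μ : Measure ℝ) : Set ℝ :=
  {x : ℝ | ∀ U : Set ℝ, IsOpen U → x ∈ U → 0 < μ U}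

/-- The Stieltjes transform `S(z) = ∫ μ(dx)/(z − x)` of a measure on `ℝ`. -/
def stieltjes (μ : Measure ℝ) (z : ℂ) : ℂ := ∫ x, (z - (x : ℂ))⁻¹ ∂μ

/-- The Sylvester matrix of `p` (of degree `≤ m`) and `q` (of degree `≤ n`):
an `(n+m) × (n+m)` matrix whose first `n` rows carry the coefficients of `p` and
whose last `m` rows carry the coefficients of `q`.  Its determinant is the
resultant `Res(p,q)`. -/
def sylvester {R : Type*} [CommRing R] (p q : Polynomial R) (m n : ℕ) :
    Matrix (Fin (n + m)) (Fin (n + m)) R :=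
  Matrix.of fun i j =>
    if (i : ℕ) < n then
      (if (j : ℕ) ≤ (i : ℕ) + m then p.coeff ((i : ℕ) + m - (j : ℕ)) else 0)
    else
      (if (j : ℕ) ≤ ((i : ℕ) - n) + n then q.coeff (((i : ℕ) - n) + n - (j : ℕ)) else 0)

/-- The discriminant (up to the usual normalizing factor `±1/aₙ`, which affects
neither its vanishing nor its zero set once multiplied by `F_n`) of a polynomial
`F(X,Y) ∈ ℂ[X][Y]` with respect to `Y`: the resultant `Res_Y(F, ∂F/∂Y)`. -/
def discY (F : Polynomial (Polynomial ℂ)) : Polynomial ℂ :=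
  (sylvester F (Polynomial.derivative F) F.natDegree (F.natDegree - 1)).det

/-- The finite set `A` of complex zeros of `F_n(X)·D(X)`. -/
def badSet (F : Polynomial (Polynomial ℂ)) : Set ℂ :=
  {z : ℂ | Polynomial.eval z (F.leadingCoeff * discY F) = 0}

/-- A function `h` of *rational beta type* on the bounded interval `(a,b)`:
real-analytic and nonnegative on `(a,b)`, with
`(x−a)^{1−c} h(x) → L_a > 0` as `x ↓ a` and `(b−x)^{1−d} h(x) → L_b > 0` as
`x ↑ b` for some positive rationals `c, d`. -/
structure RationalBetaType (h : ℝ → ℝ) (a b : ℝ) : Prop where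
  lt : a < b
  analytic : AnalyticOnNhd ℝ h (Set.Ioo a b)
  nonneg : ∀ x ∈ Set.Ioo a b, 0 ≤ h x
  left : ∃ c : ℚ, 0 < c ∧ ∃ L : ℝ, 0 < L ∧
    Tendsto (fun x : ℝ => (x - a) ^ ((1 : ℝ) - (c : ℝ)) * h x) (𝓝[>] a) (𝓝 L)
  right : ∃ d : ℚ, 0 < d ∧ ∃ L : ℝ, 0 < L ∧
    Tendsto (fun x : ℝ => (b - x) ^ ((1 : ℝ) - (d : ℝ)) * h x) (𝓝[<] b) (𝓝 L)

theorem sum_reversed_coeff_mul_pow {R : Type*} [CommRing R] (p : Polynomial R) (y : R)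
    {N s : ℕ} (h : s + p.natDegree < N) :
    ∑ j : Fin N, (if (j : ℕ) ≤ N - 1 - s then p.coeff (N - 1 - s - j) else 0) * y ^ (N - 1 - j)
      = y ^ s * p.eval y := by
  have h1 : y ^ s * p.eval y = (Polynomial.X ^ s * p).eval y := by simp
  rw [h1, Polynomial.eval_eq_sum_range' (n := N)
    (lt_of_le_of_lt (Polynomial.natDegree_mul_le.trans
      (Nat.add_le_add_right (Polynomial.natDegree_X_pow_le s) _)) h),
    ← Finset.sum_range_reflect, Finset.sum_range]
  refine Finset.sum_congr rfl fun j _ => ?_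
  rw [Polynomial.coeff_X_pow_mul']
  have hj := j.2
  congr 1
  by_cases hjs : (j : ℕ) ≤ N - 1 - s
  · rw [if_pos hjs, if_pos (by omega)]
    congr 1
    omega
  · rw [if_neg hjs, if_neg (by omega)]

theorem det_sylvester_eq_zero_of_common_root {R : Type*} [CommRing R] [IsDomain R]
    {p q : Polynomial R} {m n : ℕ} (hp : p.natDegree ≤ m) (hq : q.natDegree ≤ n)
    (hmn : 0 < n + m) {y : R} (hpy : p.eval y = 0) (hqy : q.eval y = 0) :
    (sylvester p q m n).det = 0 := by
  refine Matrix.exists_mulVec_eq_zero_iff.mp ⟨fun j => y ^ (n + m - 1 - j), fun h => ?_, ?_⟩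
  · have := congrFun h ⟨n + m - 1, by omega⟩
    simp at this
  · ext i
    have hi := i.2
    simp only [Matrix.mulVec, dotProduct, sylvester, Matrix.of_apply, Pi.zero_apply]
    by_cases hin : (i : ℕ) < n
    · have := sum_reversed_coeff_mul_pow p y (N := n + m) (s := n - 1 - i) (by omega)
      rw [hpy, mul_zero] at this
      refine (Finset.sum_congr rfl fun j _ => ?_).trans this
      rw [if_pos hin, show n + m - 1 - (n - 1 - i) = (i : ℕ) + m by omega]
    · have := sum_reversed_coeff_mul_pow q y (N := n + m) (s := n + m - 1 - i) (by omega)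
      rw [hqy, mul_zero] at this
      refine (Finset.sum_congr rfl fun j _ => ?_).trans this
      rw [if_neg hin, show n + m - 1 - (n + m - 1 - i) = (i : ℕ) - n + n by omega]

theorem sylvester_map {R S : Type*} [CommRing R] [CommRing S] (f : R →+* S)
    (p q : Polynomial R) (m n : ℕ) :
    f.mapMatrix (sylvester p q m n) = sylvester (p.map f) (q.map f) m n := by
  ext i j
  simp only [sylvester, RingHom.mapMatrix_apply, Matrix.map_apply, Matrix.of_apply,
    Polynomial.coeff_map]
  split_ifs <;> simp

theorem eval_derivative_ne_zero_of_discY_ne_zero {F : Polynomial (Polynomial ℂ)} {z y : ℂ}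
    (hF : F.natDegree ≠ 0) (hD : (discY F).eval z ≠ 0)
    (hy : (F.map (Polynomial.evalRingHom z)).eval y = 0) :
    (F.map (Polynomial.evalRingHom z)).derivative.eval y ≠ 0 := by
  intro hy'
  apply hD
  rw [← Polynomial.coe_evalRingHom, discY, RingHom.map_det, sylvester_map]
  refine det_sylvester_eq_zero_of_common_root Polynomial.natDegree_map_le ?_ (by omega) hy ?_
  · exact Polynomial.natDegree_map_le.trans (Polynomial.natDegree_derivative_le F)
  · rwa [← Polynomial.derivative_map]

theorem eval_map_evalRingHom_eq_sum (F : Polynomial (Polynomial ℂ)) (z y : ℂ) :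
    (F.map (Polynomial.evalRingHom z)).eval y
      = ∑ i ∈ Finset.range (F.natDegree + 1), (F.coeff i).eval z * y ^ i := by
  rw [Polynomial.eval_map, Polynomial.eval₂_eq_sum_range]
  simp

theorem contDiff_eval_map_evalRingHom (F : Polynomial (Polynomial ℂ)) :
    ContDiff ℂ ⊤ fun p : ℂ × ℂ => (F.map (Polynomial.evalRingHom p.1)).eval p.2 := by
  simp only [eval_map_evalRingHom_eq_sum]
  refine ContDiff.sum fun i _ => ContDiff.mul ?_ (contDiff_snd.pow i)
  exact (Polynomial.contDiff_aeval (𝕜 := ℂ) (F.coeff i) ⊤).comp contDiff_fst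

theorem eventually_norm_root_le {F : Polynomial (Polynomial ℂ)} {x : ℂ}
    (hx : F.leadingCoeff.eval x ≠ 0) :
    ∃ M : ℝ, ∀ᶠ z in 𝓝 x, ∀ y : ℂ,
      (F.map (Polynomial.evalRingHom z)).eval y = 0 → ‖y‖ ≤ M := by
  have hlc : ∀ᶠ z in 𝓝 x, F.leadingCoeff.eval z ≠ 0 :=
    F.leadingCoeff.continuous.continuousAt.eventually_ne hx
  set b : ℂ → NNReal := fun z => (Finset.range F.natDegree).sup
    (fun i => ‖(F.coeff i).eval z‖₊) / ‖F.leadingCoeff.eval z‖₊ + 1 with hb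
  have hbc : ContinuousAt b x := by
    refine ContinuousAt.add (ContinuousAt.div₀ ?_ ?_ (by simpa using hx)) continuousAt_const
    · exact (Continuous.finset_sup_apply fun i _ =>
        (F.coeff i).continuous.nnnorm).continuousAt
    · exact F.leadingCoeff.continuous.nnnorm.continuousAt
  refine ⟨(b x + 1 : NNReal), ?_⟩
  filter_upwards [hlc, hbc.eventually_lt_const (lt_add_one (b x))] with z hz hbz y hy
  have hdeg : (F.map (Polynomial.evalRingHom z)).natDegree = F.natDegree :=
    Polynomial.natDegree_map_of_leadingCoeff_ne_zero _ (by simpa using hz)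
  have h0 : F.map (Polynomial.evalRingHom z) ≠ 0 := fun h => hz <| by
    simpa using congrArg (fun p => p.coeff F.natDegree) h
  have h1 := Polynomial.IsRoot.norm_lt_cauchyBound h0 hy
  have h2 : (F.map (Polynomial.evalRingHom z)).cauchyBound = b z := by
    simp only [Polynomial.cauchyBound, hb, Polynomial.leadingCoeff, hdeg]
    simp
  rw [h2] at h1
  exact h1.le.trans (by exact_mod_cast hbz.le)

theorem eventually_root_mem_of_isOpen {F : Polynomial (Polynomial ℂ)} {x : ℂ}
    (hx : F.leadingCoeff.eval x ≠ 0) {U : Set ℂ} (hU : IsOpen U)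
    (hroots : ∀ y, (F.map (Polynomial.evalRingHom x)).eval y = 0 → y ∈ U) :
    ∀ᶠ z in 𝓝 x, ∀ y, (F.map (Polynomial.evalRingHom z)).eval y = 0 → y ∈ U := by
  obtain ⟨M, hM⟩ := eventually_norm_root_le hx
  have hK : IsCompact (Metric.closedBall (0 : ℂ) M \ U) :=
    (isCompact_closedBall _ _).diff hU
  have := hK.eventually_forall_of_forall_eventually (x₀ := x)
    (P := fun z y => (F.map (Polynomial.evalRingHom z)).eval y ≠ 0) fun y hy =>
      (contDiff_eval_map_evalRingHom F).continuous.continuousAt.eventually_ne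
        fun h => hy.2 (hroots y h)
  filter_upwards [hM, this] with z hz hz' y hy
  by_contra hyU
  exact hz' y ⟨by simpa using hz y hy, hyU⟩ hy

/-- The roots of `F(z, ·)` selected continuously in the upper half plane converge at a real
boundary point where the leading coefficient of `F` does not vanish. -/
theorem exists_tendsto_root {F : Polynomial (Polynomial ℂ)} {x : ℝ}
    (hx : F.leadingCoeff.eval (x : ℂ) ≠ 0) {S : ℂ → ℂ}
    (hS : ContinuousOn S {z | 0 < z.im})
    (hFS : ∀ z : ℂ, 0 < z.im → (F.map (Polynomial.evalRingHom z)).eval (S z) = 0) :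
    ∃ y, (F.map (Polynomial.evalRingHom (x : ℂ))).eval y = 0 ∧
      Tendsto S (𝓝[{z | 0 < z.im}] (x : ℂ)) (𝓝 y) := by
  have h0 : F.map (Polynomial.evalRingHom (x : ℂ)) ≠ 0 := fun h => hx <| by
    simpa using congrArg (fun p => p.coeff F.natDegree) h
  set R : Set ℂ := {y | (F.map (Polynomial.evalRingHom (x : ℂ))).eval y = 0} with hR
  have hRfin : R.Finite := by
    simpa [hR, Polynomial.IsRoot] using Polynomial.finite_setOfPred_isRoot h0
  obtain ⟨U, hU, hdisj⟩ := hRfin.t2_separation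
  have hev := eventually_root_mem_of_isOpen hx (U := ⋃ y ∈ R, U y)
    (isOpen_biUnion fun y _ => (hU y).2) (fun y hy => Set.mem_biUnion hy (hU y).1)
  obtain ⟨δ, hδ, hball⟩ := Metric.eventually_nhds_iff_ball.mp hev
  set B : Set ℂ := Metric.ball (x : ℂ) δ ∩ {z | 0 < z.im} with hB
  have hBconn : IsPreconnected B :=
    ((convex_ball _ _).inter (convex_halfSpace_im_gt 0)).isPreconnected
  have hSB : S '' B ⊆ ⋃ y ∈ R, U y := by
    rintro _ ⟨z, hz, rfl⟩
    exact hball z hz.1 _ (hFS z hz.2)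
  have hBne : (x : ℂ) + (δ / 2 : ℝ) * Complex.I ∈ B := by
    refine ⟨?_, ?_⟩
    · rw [Metric.mem_ball, dist_eq_norm]
      simp only [add_sub_cancel_left, norm_mul, Complex.norm_real, Complex.norm_I, mul_one,
        Real.norm_eq_abs, abs_of_pos (half_pos hδ)]
      linarith
    · simp [hδ]
  obtain ⟨y, hyR, hy⟩ := Set.mem_iUnion₂.mp (hSB ⟨_, hBne, rfl⟩)
  have hdisj' : Disjoint (U y) (⋃ w ∈ R \ {y}, U w) := by
    rw [Set.disjoint_iUnion₂_right]
    exact fun w hw => hdisj hyR hw.1 (Ne.symm hw.2)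
  have hSBy : S '' B ⊆ U y := by
    refine (hBconn.image S (hS.mono Set.inter_subset_right)).subset_left_of_subset_union
      (hU y).2 (isOpen_biUnion fun w _ => (hU w).2) hdisj' (fun s hs => ?_)
      ⟨_, ⟨_, hBne, rfl⟩, hy⟩
    obtain ⟨w, hwR, hw⟩ := Set.mem_iUnion₂.mp (hSB hs)
    by_cases hwy : w = y
    · exact Or.inl (hwy ▸ hw)
    · exact Or.inr (Set.mem_biUnion (show w ∈ R \ {y} from ⟨hwR, hwy⟩) hw)
  refine ⟨y, hyR, tendsto_nhds.mpr fun W hW hyW => ?_⟩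
  have hev' := eventually_root_mem_of_isOpen hx (U := W ∪ ⋃ w ∈ R \ {y}, U w)
    (hW.union (isOpen_biUnion fun w _ => (hU w).2)) (fun w hw => by
      by_cases hwy : w = y
      · exact Or.inl (hwy ▸ hyW)
      · exact Or.inr (Set.mem_biUnion (show w ∈ R \ {y} from ⟨hw, hwy⟩) (hU w).1))
  filter_upwards [self_mem_nhdsWithin, hev'.filter_mono nhdsWithin_le_nhds,
    mem_nhdsWithin_of_mem_nhds (Metric.ball_mem_nhds (x : ℂ) hδ)] with z hz hz' hzB
  refine (hz' _ (hFS z hz)).resolve_right fun h => ?_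
  exact Set.disjoint_left.mp hdisj' (hSBy ⟨z, ⟨hzB, hz⟩, rfl⟩) h

/-- Off the bad set, a root of `F(z, ·)` selected continuously in the upper half plane extends
analytically across the real axis. -/
theorem exists_analyticAt_extension {F : Polynomial (Polynomial ℂ)} {x : ℝ}
    (hF : F.natDegree ≠ 0) (hx : (x : ℂ) ∉ badSet F) {S : ℂ → ℂ}
    (hS : ContinuousOn S {z | 0 < z.im})
    (hFS : ∀ z : ℂ, 0 < z.im → (F.map (Polynomial.evalRingHom z)).eval (S z) = 0) :
    ∃ g : ℂ → ℂ, AnalyticAt ℂ g x ∧ ∀ᶠ z in 𝓝 (x : ℂ), 0 < z.im → S z = g z := by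
  simp only [badSet, Set.mem_ofPred_eq, Polynomial.eval_mul, mul_eq_zero, not_or] at hx
  obtain ⟨y, hy, hlim⟩ := exists_tendsto_root hx.1 hS hFS
  have hcd : ContDiffAt ℂ ⊤ (fun p : ℂ × ℂ => (F.map (Polynomial.evalRingHom p.1)).eval p.2)
    ((x : ℂ), y) := (contDiff_eval_map_evalRingHom F).contDiffAt
  set Φ := fun p : ℂ × ℂ => (F.map (Polynomial.evalRingHom p.1)).eval p.2 with hΦ
  have hd := eval_derivative_ne_zero_of_discY_ne_zero hF hx.2 hy
  have hinv : (fderiv ℂ Φ ((x : ℂ), y) ∘L .inr ℂ ℂ ℂ).IsInvertible := by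
    have h1 : HasFDerivAt (fun w : ℂ => Φ ((x : ℂ), w))
        (fderiv ℂ Φ ((x : ℂ), y) ∘L .inr ℂ ℂ ℂ) y :=
      (hcd.differentiableAt (by simp)).hasFDerivAt.comp y (hasFDerivAt_prodMk_right _ _)
    have h2 : HasDerivAt (fun w : ℂ => Φ ((x : ℂ), w)) _ y :=
      (F.map (Polynomial.evalRingHom (x : ℂ))).hasDerivAt y
    rw [h1.unique h2.hasFDerivAt]
    exact ⟨ContinuousLinearEquiv.unitsEquivAut ℂ (Units.mk0 _ hd), by ext; simp⟩
  refine ⟨hcd.implicitFunction (by simp) hinv,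
    (hcd.contDiffAt_implicitFunction (by simp) hinv).analyticAt, ?_⟩
  have hev := hcd.eventually_apply_eq_iff_implicitFunction (by simp) hinv
  have ht : Tendsto (fun z => (z, S z)) (𝓝[{z | 0 < z.im}] (x : ℂ)) (𝓝 ((x : ℂ), y)) :=
    (tendsto_id.mono_left nhdsWithin_le_nhds).prodMk_nhds hlim
  have := ht.eventually hev
  rw [eventually_nhdsWithin_iff] at this
  filter_upwards [this] with z hz him
  exact ((hz him).mp ((hFS z him).trans hy.symm)).symm

theorem abs_im_le_norm_sub_ofReal (z : ℂ) (x : ℝ) : |z.im| ≤ ‖z - (x : ℂ)‖ := by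
  simpa using Complex.abs_im_le_norm (z - (x : ℂ))

theorem measurable_inv_sub_ofReal (z : ℂ) : Measurable fun x : ℝ => (z - (x : ℂ))⁻¹ :=
  (measurable_const.sub Complex.measurable_ofReal).inv

theorem norm_inv_sub_ofReal_le {z : ℂ} {r : ℝ} (hr : 0 < r) (hz : r ≤ z.im) (x : ℝ) :
    ‖(z - (x : ℂ))⁻¹‖ ≤ r⁻¹ := by
  rw [norm_inv]
  exact inv_anti₀ hr (hz.trans ((le_abs_self _).trans (abs_im_le_norm_sub_ofReal z x)))

theorem integrable_inv_sub_ofReal (μ : Measure ℝ) [IsFiniteMeasure μ] {z : ℂ} (hz : 0 < z.im) :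
    Integrable (fun x : ℝ => (z - (x : ℂ))⁻¹) μ :=
  Integrable.of_bound (measurable_inv_sub_ofReal z).aestronglyMeasurable z.im⁻¹
    (ae_of_all _ (norm_inv_sub_ofReal_le hz le_rfl))

theorem continuousOn_stieltjes (μ : Measure ℝ) [IsFiniteMeasure μ] :
    ContinuousOn (stieltjes μ) {z | 0 < z.im} := by
  intro z hz
  have hz : 0 < z.im := hz
  refine ContinuousAt.continuousWithinAt ?_
  refine continuousAt_of_dominated (bound := fun _ => (z.im / 2)⁻¹)
    (Eventually.of_forall fun w => (measurable_inv_sub_ofReal w).aestronglyMeasurable) ?_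
    (integrable_const _) (ae_of_all _ fun x => ?_)
  · filter_upwards [Complex.continuous_im.continuousAt.eventually_const_lt (half_lt_self hz)]
      with w hw
    exact ae_of_all _ (norm_inv_sub_ofReal_le (half_pos hz) hw.le)
  · refine ContinuousAt.inv₀ (by fun_prop) fun h => ?_
    have := abs_im_le_norm_sub_ofReal z x
    rw [h, norm_zero, abs_of_pos hz] at this
    linarith

theorem neg_im_inv_sub_ofReal (x y ε : ℝ) :
    -((((x : ℂ) + ε * Complex.I) - (y : ℂ))⁻¹).im = ε / ((x - y) ^ 2 + ε ^ 2) := by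
  rw [Complex.inv_im, Complex.normSq_apply]
  simp
  ring

theorem neg_im_stieltjes (μ : Measure ℝ) [IsFiniteMeasure μ] {ε : ℝ} (hε : 0 < ε) (x : ℝ) :
    -(stieltjes μ ((x : ℂ) + ε * Complex.I)).im = ∫ y, ε / ((x - y) ^ 2 + ε ^ 2) ∂μ := by
  have hi := integrable_inv_sub_ofReal μ (z := (x : ℂ) + ε * Complex.I) (by simpa using hε)
  have := integral_im (𝕜 := ℂ) hi
  simp only [stieltjes]
  change -RCLike.im (K := ℂ) _ = _
  rw [← this, ← integral_neg]
  exact integral_congr_ae (ae_of_all _ fun y => neg_im_inv_sub_ofReal x y ε)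

theorem poisson_le_inv {ε : ℝ} (hε : 0 < ε) (t : ℝ) : ε / (t ^ 2 + ε ^ 2) ≤ ε⁻¹ := by
  rw [div_le_iff₀ (by positivity)]
  have : 0 ≤ ε⁻¹ * t ^ 2 := by positivity
  have h2 : ε⁻¹ * ε ^ 2 = ε := by field_simp
  nlinarith

theorem integral_poisson {ε : ℝ} (hε : 0 < ε) (α β y : ℝ) :
    ∫ x in α..β, ε / ((x - y) ^ 2 + ε ^ 2)
      = Real.arctan ((β - y) / ε) - Real.arctan ((α - y) / ε) := by
  refine intervalIntegral.integral_eq_sub_of_hasDerivAt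
    (f := fun x => Real.arctan ((x - y) / ε)) (fun x _ => ?_) ?_
  · have h := (((hasDerivAt_id x).sub_const y).div_const ε).arctan
    convert! h using 1
    simp only [id]
    have : (1 + ((x - y) / ε) ^ 2) ≠ 0 := by positivity
    have : ((x - y) ^ 2 + ε ^ 2) ≠ 0 := by positivity
    field_simp
    ring
  · refine Continuous.intervalIntegrable (Continuous.div (by fun_prop) (by fun_prop) ?_) _ _
    intro x
    positivity

theorem integral_neg_im_stieltjes (μ : Measure ℝ) [IsFiniteMeasure μ] {ε : ℝ} (hε : 0 < ε)
    (α β : ℝ) :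
    ∫ x in α..β, -(stieltjes μ ((x : ℂ) + ε * Complex.I)).im
      = ∫ y, (Real.arctan ((β - y) / ε) - Real.arctan ((α - y) / ε)) ∂μ := by
  simp_rw [neg_im_stieltjes μ hε, ← integral_poisson hε]
  have : IsFiniteMeasure (volume.restrict (Set.uIoc α β)) :=
    ⟨by simp [Set.uIoc]⟩
  refine intervalIntegral_integral_swap ?_
  refine Integrable.of_bound (C := ε⁻¹) ?_ (ae_of_all _ fun p => ?_)
  · refine Continuous.aestronglyMeasurable ?_
    refine Continuous.div (by fun_prop) (by fun_prop) fun p => ?_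
    positivity
  · simp only [Function.uncurry]
    rw [Real.norm_of_nonneg (by positivity)]
    exact poisson_le_inv hε _

theorem tendsto_arctan_div_of_pos {c : ℝ} (hc : 0 < c) :
    Tendsto (fun ε : ℝ => Real.arctan (c / ε)) (𝓝[>] 0) (𝓝 (Real.pi / 2)) := by
  refine (Real.tendsto_arctan_atTop.mono_right nhdsWithin_le_nhds).comp ?_
  exact (tendsto_inv_nhdsGT_zero.const_mul_atTop hc).congr fun ε => (div_eq_mul_inv c ε).symm

theorem tendsto_arctan_div_of_neg {c : ℝ} (hc : c < 0) :
    Tendsto (fun ε : ℝ => Real.arctan (c / ε)) (𝓝[>] 0) (𝓝 (-(Real.pi / 2))) := by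
  have := (tendsto_arctan_div_of_pos (neg_pos.mpr hc)).neg
  refine this.congr fun ε => ?_
  rw [← Real.arctan_neg]
  congr 1
  ring

/-- Stieltjes inversion for an interval whose endpoints carry no mass. -/
theorem tendsto_integral_neg_im_stieltjes (μ : Measure ℝ) [IsFiniteMeasure μ] {α β : ℝ}
    (hαβ : α ≤ β) (hα : μ {α} = 0) (hβ : μ {β} = 0) :
    Tendsto (fun ε : ℝ => ∫ x in α..β, -(stieltjes μ ((x : ℂ) + ε * Complex.I)).im)
      (𝓝[>] 0) (𝓝 (Real.pi * μ.real (Set.Ioc α β))) := by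
  have h1 : ∀ᶠ ε : ℝ in 𝓝[>] 0,
      ∫ y, (Real.arctan ((β - y) / ε) - Real.arctan ((α - y) / ε)) ∂μ
        = ∫ x in α..β, -(stieltjes μ ((x : ℂ) + ε * Complex.I)).im := by
    filter_upwards [self_mem_nhdsWithin] with ε hε
    exact (integral_neg_im_stieltjes μ hε α β).symm
  refine Tendsto.congr' h1 ?_
  have h2 : Real.pi * μ.real (Set.Ioc α β)
      = ∫ y, (Set.Ioc α β).indicator (fun _ => Real.pi) y ∂μ := by
    rw [integral_indicator_const _ measurableSet_Ioc, smul_eq_mul, mul_comm]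
  rw [h2]
  refine tendsto_integral_filter_of_dominated_convergence (fun _ => Real.pi)
    (Eventually.of_forall fun ε => ?_) (Eventually.of_forall fun ε => ae_of_all _ fun y => ?_)
    (integrable_const _) ?_
  · refine Measurable.aestronglyMeasurable ?_
    exact (Real.measurable_arctan.comp (by fun_prop)).sub
      (Real.measurable_arctan.comp (by fun_prop))
  · have a1 := Real.arctan_lt_pi_div_two ((β - y) / ε)
    have a2 := Real.neg_pi_div_two_lt_arctan ((β - y) / ε)
    have a3 := Real.arctan_lt_pi_div_two ((α - y) / ε)
    have a4 := Real.neg_pi_div_two_lt_arctan ((α - y) / ε)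
    rw [Real.norm_eq_abs, abs_le]
    constructor <;> linarith
  · have hα' : ∀ᵐ y ∂μ, y ≠ α := by simpa [ae_iff] using hα
    have hβ' : ∀ᵐ y ∂μ, y ≠ β := by simpa [ae_iff] using hβ
    filter_upwards [hα', hβ'] with y hyα hyβ
    rcases lt_or_gt_of_ne hyα with h | h
    · rw [Set.indicator_of_notMem (fun hy => (hy.1.trans h).false)]
      simpa using (tendsto_arctan_div_of_pos (c := β - y) (by linarith)).sub
        (tendsto_arctan_div_of_pos (c := α - y) (by linarith))
    rcases lt_or_gt_of_ne hyβ with h' | h'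
    · rw [Set.indicator_of_mem (show y ∈ Set.Ioc α β from ⟨h, h'.le⟩)]
      have := (tendsto_arctan_div_of_pos (c := β - y) (by linarith)).sub
        (tendsto_arctan_div_of_neg (c := α - y) (by linarith))
      rwa [sub_neg_eq_add, add_halves] at this
    · rw [Set.indicator_of_notMem (fun hy => (hy.2.trans_lt h').false)]
      simpa using (tendsto_arctan_div_of_neg (c := β - y) (by linarith)).sub
        (tendsto_arctan_div_of_neg (c := α - y) (by linarith))

theorem real_singleton_le_mul_norm_stieltjes (μ : Measure ℝ) [IsFiniteMeasure μ] {ε : ℝ}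
    (hε : 0 < ε) (x : ℝ) :
    μ.real {x} ≤ ε * ‖stieltjes μ ((x : ℂ) + ε * Complex.I)‖ := by
  have hInt : Integrable (fun y => ε / ((x - y) ^ 2 + ε ^ 2)) μ := by
    refine Integrable.of_bound (C := ε⁻¹) ?_ (ae_of_all _ fun y => ?_)
    · refine Continuous.aestronglyMeasurable
        (Continuous.div (by fun_prop) (by fun_prop) fun y => ?_)
      positivity
    · rw [Real.norm_of_nonneg (by positivity)]
      exact poisson_le_inv hε _
  have h1 := setIntegral_le_integral (s := {x}) hInt (ae_of_all _ fun y => by positivity)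
  rw [integral_singleton, ← neg_im_stieltjes μ hε] at h1
  have h2 := (neg_le_abs _).trans
    (Complex.abs_im_le_norm (stieltjes μ ((x : ℂ) + ε * Complex.I)))
  have h3 := mul_le_mul_of_nonneg_left (h1.trans h2) hε.le
  refine le_trans (le_of_eq ?_) h3
  simp
  field_simp

section Extension

variable {x₀ δ M : ℝ} {g : ℂ → ℂ}

theorem ofReal_add_mul_I_mem_ball {x ε : ℝ} (hε : 0 ≤ ε) (h : |x - x₀| + ε < δ) :
    (x : ℂ) + ε * Complex.I ∈ Metric.ball (x₀ : ℂ) δ := by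
  rw [Metric.mem_ball, dist_eq_norm]
  refine lt_of_le_of_lt ?_ h
  have : (x : ℂ) + ε * Complex.I - x₀ = ((x - x₀ : ℝ) : ℂ) + ε * Complex.I := by
    push_cast
    ring
  rw [this]
  exact (norm_add_le _ _).trans (add_le_add (by rw [Complex.norm_real, Real.norm_eq_abs])
    (by simp [abs_of_nonneg hε]))

theorem ofReal_mem_ball {x : ℝ} (hx : x ∈ Set.Ioo (x₀ - δ) (x₀ + δ)) :
    (x : ℂ) ∈ Metric.ball (x₀ : ℂ) δ := by
  simpa using ofReal_add_mul_I_mem_ball (x₀ := x₀) (δ := δ) (x := x) le_rfl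
    (by rw [add_zero, abs_lt]; constructor <;> linarith [hx.1, hx.2])

theorem tendsto_extension (hg : ContinuousOn g (Metric.ball (x₀ : ℂ) δ)) {x : ℝ}
    (hx : x ∈ Set.Ioo (x₀ - δ) (x₀ + δ)) :
    Tendsto (fun ε : ℝ => g ((x : ℂ) + ε * Complex.I)) (𝓝[>] 0) (𝓝 (g x)) := by
  have hc : ContinuousAt g x := hg.continuousAt (Metric.isOpen_ball.mem_nhds (ofReal_mem_ball hx))
  have : Tendsto (fun ε : ℝ => (x : ℂ) + ε * Complex.I) (𝓝 0) (𝓝 x) := by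
    have : Continuous fun ε : ℝ => (x : ℂ) + ε * Complex.I := by fun_prop
    simpa using this.tendsto 0
  exact hc.tendsto.comp (this.mono_left nhdsWithin_le_nhds)

theorem eventually_stieltjes_eq_extension {μ : Measure ℝ}
    (hSg : ∀ z ∈ Metric.ball (x₀ : ℂ) δ, 0 < z.im → stieltjes μ z = g z)
    {α β : ℝ} (hα : x₀ - δ < α) (hβ : β < x₀ + δ) :
    ∀ᶠ ε : ℝ in 𝓝[>] 0, 0 < ε ∧ ∀ x ∈ Set.Icc α β,
      (x : ℂ) + ε * Complex.I ∈ Metric.ball (x₀ : ℂ) δ ∧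
      stieltjes μ ((x : ℂ) + ε * Complex.I) = g ((x : ℂ) + ε * Complex.I) := by
  have hpos : 0 < min (α - (x₀ - δ)) (x₀ + δ - β) := lt_min (by linarith) (by linarith)
  filter_upwards [Ioo_mem_nhdsGT hpos] with ε hε
  refine ⟨hε.1, fun x hx => ?_⟩
  have h1 := hε.2.trans_le (min_le_left _ _)
  have h2 := hε.2.trans_le (min_le_right _ _)
  have hmem : (x : ℂ) + ε * Complex.I ∈ Metric.ball (x₀ : ℂ) δ := by
    refine ofReal_add_mul_I_mem_ball hε.1.le ?_
    have : |x - x₀| < δ - ε := by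
      rw [abs_lt]
      constructor <;> linarith [hx.1, hx.2]
    linarith
  exact ⟨hmem, hSg _ hmem (by simpa using hε.1)⟩

theorem extension_neg_im_nonneg (μ : Measure ℝ) [IsFiniteMeasure μ]
    (hg : ContinuousOn g (Metric.ball (x₀ : ℂ) δ))
    (hSg : ∀ z ∈ Metric.ball (x₀ : ℂ) δ, 0 < z.im → stieltjes μ z = g z)
    {x : ℝ} (hx : x ∈ Set.Ioo (x₀ - δ) (x₀ + δ)) : 0 ≤ -(g x).im := by
  refine ge_of_tendsto ((Complex.continuous_im.tendsto _).comp (tendsto_extension hg hx)).neg ?_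
  filter_upwards [eventually_stieltjes_eq_extension hSg hx.1 hx.2] with ε hε
  simp only [Function.comp]
  rw [← (hε.2 x ⟨le_rfl, le_rfl⟩).2, neg_im_stieltjes μ hε.1]
  have := hε.1
  exact integral_nonneg fun y => by positivity

theorem measure_singleton_eq_zero_of_extension (μ : Measure ℝ) [IsFiniteMeasure μ]
    (hM : ∀ z ∈ Metric.ball (x₀ : ℂ) δ, ‖g z‖ ≤ M)
    (hSg : ∀ z ∈ Metric.ball (x₀ : ℂ) δ, 0 < z.im → stieltjes μ z = g z)
    {x : ℝ} (hx : x ∈ Set.Ioo (x₀ - δ) (x₀ + δ)) : μ {x} = 0 := by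
  have hlim : Tendsto (fun ε : ℝ => ε * M) (𝓝[>] 0) (𝓝 0) := by
    have : Tendsto (fun ε : ℝ => ε * M) (𝓝 0) (𝓝 (0 * M)) := tendsto_id.mul_const M
    simpa using this.mono_left nhdsWithin_le_nhds
  have : μ.real {x} ≤ 0 := by
    refine ge_of_tendsto hlim ?_
    filter_upwards [eventually_stieltjes_eq_extension hSg hx.1 hx.2] with ε hε
    obtain ⟨hmem, heq⟩ := hε.2 x ⟨le_rfl, le_rfl⟩
    refine (real_singleton_le_mul_norm_stieltjes μ hε.1 x).trans ?_
    rw [heq]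
    exact mul_le_mul_of_nonneg_left (hM _ hmem) hε.1.le
  have h0 : μ.real {x} = 0 := le_antisymm this measureReal_nonneg
  exact (measureReal_eq_zero_iff).mp h0

theorem continuousOn_ofReal_of_ball (hg : ContinuousOn g (Metric.ball (x₀ : ℂ) δ)) :
    ContinuousOn (fun x : ℝ => g x) (Set.Ioo (x₀ - δ) (x₀ + δ)) :=
  hg.comp Complex.continuous_ofReal.continuousOn fun _ hx => ofReal_mem_ball hx

theorem pi_mul_measure_Ioc_of_extension (μ : Measure ℝ) [IsFiniteMeasure μ]
    (hg : ContinuousOn g (Metric.ball (x₀ : ℂ) δ))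
    (hM : ∀ z ∈ Metric.ball (x₀ : ℂ) δ, ‖g z‖ ≤ M)
    (hSg : ∀ z ∈ Metric.ball (x₀ : ℂ) δ, 0 < z.im → stieltjes μ z = g z)
    {α β : ℝ} (hα : x₀ - δ < α) (hαβ : α ≤ β) (hβ : β < x₀ + δ) :
    Real.pi * μ.real (Set.Ioc α β) = ∫ x in α..β, -(g x).im := by
  have hαm := measure_singleton_eq_zero_of_extension μ hM hSg
    (x := α) ⟨hα, by linarith⟩
  have hβm := measure_singleton_eq_zero_of_extension μ hM hSg
    (x := β) ⟨by linarith, hβ⟩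
  refine tendsto_nhds_unique (tendsto_integral_neg_im_stieltjes μ hαβ hαm hβm) ?_
  have hev := eventually_stieltjes_eq_extension hSg hα hβ
  have hsub : Set.uIoc α β ⊆ Set.Icc α β := by
    rw [Set.uIoc_of_le hαβ]
    exact Set.Ioc_subset_Icc_self
  refine intervalIntegral.tendsto_integral_filter_of_dominated_convergence (fun _ => M)
    ?_ ?_ intervalIntegrable_const (ae_of_all _ fun x hx => ?_)
  · filter_upwards [self_mem_nhdsWithin] with ε hε
    refine Continuous.aestronglyMeasurable ?_
    refine (Complex.continuous_im.comp (ContinuousOn.comp_continuous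
      (continuousOn_stieltjes μ) (by fun_prop) fun x => ?_)).neg
    simpa using hε
  · filter_upwards [hev] with ε hε
    refine ae_of_all _ fun x hx => ?_
    obtain ⟨hmem, heq⟩ := hε.2 x (hsub hx)
    rw [norm_neg, heq]
    exact (Complex.abs_im_le_norm _).trans (hM _ hmem)
  · have hx' : x ∈ Set.Ioo (x₀ - δ) (x₀ + δ) :=
      ⟨hα.trans_le (hsub hx).1, (hsub hx).2.trans_lt hβ⟩
    have hlim := ((Complex.continuous_im.tendsto _).comp (tendsto_extension hg hx')).neg
    refine hlim.congr' ?_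
    filter_upwards [hev] with ε hε
    simp only [Function.comp]
    rw [(hε.2 x (hsub hx)).2]

theorem measure_Ioc_of_extension (μ : Measure ℝ) [IsFiniteMeasure μ]
    (hg : ContinuousOn g (Metric.ball (x₀ : ℂ) δ))
    (hM : ∀ z ∈ Metric.ball (x₀ : ℂ) δ, ‖g z‖ ≤ M)
    (hSg : ∀ z ∈ Metric.ball (x₀ : ℂ) δ, 0 < z.im → stieltjes μ z = g z)
    {α β : ℝ} (hα : x₀ - δ < α) (hβ : β < x₀ + δ) :
    μ (Set.Ioc α β)
      = (volume.withDensity fun x : ℝ => ENNReal.ofReal (-(g x).im / Real.pi)) (Set.Ioc α β) := by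
  rcases le_or_gt α β with hαβ | hαβ
  swap
  · simp [Set.Ioc_eq_empty_of_le hαβ.le]
  have hsub : Set.Icc α β ⊆ Set.Ioo (x₀ - δ) (x₀ + δ) :=
    fun x hx => ⟨hα.trans_le hx.1, hx.2.trans_lt hβ⟩
  have hc : ContinuousOn (fun x : ℝ => -(g x).im / Real.pi) (Set.Icc α β) :=
    (Complex.continuous_im.comp_continuousOn
      ((continuousOn_ofReal_of_ball hg).mono hsub)).neg.div_const _
  have key := pi_mul_measure_Ioc_of_extension μ hg hM hSg hα hαβ hβ
  rw [withDensity_apply _ measurableSet_Ioc, ← ofReal_integral_eq_lintegral_ofReal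
      (hc.integrableOn_Icc.mono_set Set.Ioc_subset_Icc_self), integral_div,
      ← intervalIntegral.integral_of_le hαβ, ← key, mul_div_cancel_left₀ _ Real.pi_ne_zero,
      ofReal_measureReal]
  refine (ae_restrict_iff' measurableSet_Ioc).mpr (ae_of_all _ fun x hx => ?_)
  exact div_nonneg (extension_neg_im_nonneg μ hg hSg (hsub (Set.Ioc_subset_Icc_self hx)))
    Real.pi_pos.le

theorem restrict_Ioc_eq_withDensity_of_extension (μ : Measure ℝ) [IsFiniteMeasure μ]
    (hg : ContinuousOn g (Metric.ball (x₀ : ℂ) δ))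
    (hM : ∀ z ∈ Metric.ball (x₀ : ℂ) δ, ‖g z‖ ≤ M)
    (hSg : ∀ z ∈ Metric.ball (x₀ : ℂ) δ, 0 < z.im → stieltjes μ z = g z)
    {α β : ℝ} (hα : x₀ - δ < α) (hβ : β < x₀ + δ) :
    μ.restrict (Set.Ioc α β)
      = (volume.withDensity fun x : ℝ => ENNReal.ofReal (-(g x).im / Real.pi)).restrict
          (Set.Ioc α β) := by
  refine Measure.ext_of_Ioc _ _ fun c d _ => ?_
  rw [Measure.restrict_apply measurableSet_Ioc, Measure.restrict_apply measurableSet_Ioc,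
    Set.Ioc_inter_Ioc]
  exact measure_Ioc_of_extension μ hg hM hSg (hα.trans_le le_sup_right)
    (inf_le_right.trans_lt hβ)

end Extension

theorem exists_tendsto_eval_div_pow {p : Polynomial ℂ} (hp : p ≠ 0) :
    ∃ e : ℕ, ∃ c : ℂ, c ≠ 0 ∧
      Tendsto (fun t : ℝ => p.eval (t : ℂ) / (t : ℂ) ^ e) (𝓝[>] 0) (𝓝 c) := by
  obtain ⟨n, r, hr, hdvd⟩ : ∃ (n : ℕ) (r : Polynomial ℂ),
      p = (Polynomial.X - Polynomial.C 0) ^ n * r ∧ ¬ Polynomial.X - Polynomial.C 0 ∣ r :=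
    ⟨_, Polynomial.exists_eq_pow_rootMultiplicity_mul_and_not_dvd p hp 0⟩
  refine ⟨n, r.eval 0,
    fun h => hdvd (Polynomial.dvd_iff_isRoot.mpr h), ?_⟩
  have hcont : Continuous fun t : ℝ => r.eval (t : ℂ) :=
    r.continuous.comp Complex.continuous_ofReal
  have h0 : Tendsto (fun t : ℝ => r.eval (t : ℂ)) (𝓝[>] 0) (𝓝 (r.eval 0)) := by
    simpa using (hcont.tendsto 0).mono_left nhdsWithin_le_nhds
  refine h0.congr' ?_
  filter_upwards [self_mem_nhdsWithin] with t ht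
  have ht : (t : ℂ) ≠ 0 := by exact_mod_cast (ne_of_gt ht)
  rw [hr, Polynomial.eval_mul, Polynomial.eval_pow, Polynomial.eval_sub, Polynomial.eval_X,
    Polynomial.eval_C, sub_zero]
  field_simp

/-- If `φ` is eventually positive and eventually avoids crossing all but finitely many levels,
then `φ` tends to a nonnegative limit or to infinity. -/
theorem tendsto_nhds_or_atTop_of_eventually_lt_or_gt {ι : Type*} {l : Filter ι} [l.NeBot]
    {φ : ι → ℝ} {E : Set ℝ} (hE : E.Finite) (hpos : ∀ᶠ t in l, 0 < φ t)
    (h : ∀ c, 0 < c → c ∉ E → (∀ᶠ t in l, φ t < c) ∨ ∀ᶠ t in l, c < φ t) :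
    Tendsto φ l atTop ∨ ∃ L, 0 ≤ L ∧ Tendsto φ l (𝓝 L) := by
  have hdense : Dense Eᶜ := hE.countable.dense_compl ℝ
  by_cases hb : ∃ c, 0 < c ∧ c ∉ E ∧ ∀ᶠ t in l, φ t < c
  · right
    obtain ⟨c, -, -, hc⟩ := hb
    obtain ⟨L, hL⟩ := tendsto_of_no_upcrossings (f := l) (u := φ) hdense
      (fun a ha b _ hab ⟨h1, h2⟩ => by
        rcases le_or_gt a 0 with ha0 | ha0
        · exact h1 (hpos.mono fun t ht => by linarith)
        · rcases h a ha0 ha with h3 | h3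
          · exact h2 (h3.mono fun t ht => by linarith)
          · exact h1 (h3.mono fun t ht => by linarith))
      (isBoundedUnder_of_eventually_le (hc.mono fun t ht => ht.le))
      (isBoundedUnder_of_eventually_ge (hpos.mono fun t ht => ht.le))
    exact ⟨L, ge_of_tendsto hL (hpos.mono fun t ht => ht.le), hL⟩
  · left
    refine tendsto_atTop.mpr fun b => ?_
    obtain ⟨c, hcE, hbc⟩ := hdense.exists_gt (max b 0)
    have hc0 : 0 < c := (le_max_right _ _).trans_lt hbc
    rcases h c hc0 hcE with h3 | h3
    · exact absurd ⟨c, hc0, hcE, h3⟩ hb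
    · exact h3.mono fun t ht => ((le_max_left _ _).trans_lt (hbc.trans ht)).le

theorem eventually_lt_or_gt_of_eventually_ne {φ : ℝ → ℝ} {r c : ℝ} (hr : 0 < r)
    (hφ : ContinuousOn φ (Set.Ioo 0 r)) (h : ∀ᶠ t in 𝓝[>] (0 : ℝ), φ t ≠ c) :
    (∀ᶠ t in 𝓝[>] (0 : ℝ), φ t < c) ∨ ∀ᶠ t in 𝓝[>] (0 : ℝ), c < φ t := by
  obtain ⟨s, hs, hsub⟩ := (mem_nhdsGT_iff_exists_Ioo_subset' (one_pos : (0:ℝ) < 1)).mp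
    (h.and (Ioo_mem_nhdsGT hr))
  have hs0 : (0 : ℝ) < s := hs
  have hc : ContinuousOn φ (Set.Ioo 0 s) := hφ.mono fun t ht => (hsub ht).2
  have hm : Set.Ioo 0 s ∈ 𝓝[>] (0 : ℝ) := Ioo_mem_nhdsGT hs0
  by_cases hlt : ∀ t ∈ Set.Ioo 0 s, φ t < c
  · exact Or.inl (mem_of_superset hm hlt)
  · right
    push Not at hlt
    obtain ⟨t₁, ht₁, h₁⟩ := hlt
    refine mem_of_superset hm fun t ht => ?_
    by_contra hcon
    have hcon : φ t ≤ c := not_lt.mp hcon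
    obtain ⟨t', ht', h'⟩ := isPreconnected_Ioo.intermediate_value ht ht₁ hc ⟨hcon, h₁⟩
    exact (hsub ht').1 h'

theorem exists_forall_isLittleO_of_pairwise {ι α : Type*} {l : Filter α} {f : ι → α → ℝ}
    (s : Finset ι) (hs : s.Nonempty)
    (h : ∀ i ∈ s, ∀ j ∈ s, i ≠ j → f i =o[l] f j ∨ f j =o[l] f i) :
    ∃ i ∈ s, ∀ j ∈ s, j ≠ i → f j =o[l] f i := by
  induction hs using Finset.Nonempty.cons_induction with
  | singleton a => exact ⟨a, by simp, fun j hj hja => absurd (by simpa using hj) hja⟩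
  | cons a s ha hs ih =>
    obtain ⟨i, hi, hmax⟩ := ih fun i hi j hj =>
      h i (Finset.mem_cons_of_mem hi) j (Finset.mem_cons_of_mem hj)
    have hai : a ≠ i := fun h => ha (h ▸ hi)
    rcases h a (Finset.mem_cons_self a s) i (Finset.mem_cons_of_mem hi) hai with h' | h'
    · refine ⟨i, Finset.mem_cons_of_mem hi, fun j hj hji => ?_⟩
      rcases Finset.mem_cons.mp hj with rfl | hj
      · exact h'
      · exact hmax j hj hji
    · refine ⟨a, Finset.mem_cons_self a s, fun j hj hja => ?_⟩
      have hj := (Finset.mem_cons.mp hj).resolve_left hja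
      by_cases hji : j = i
      · exact hji ▸ h'
      · exact (hmax j hj hji).trans h'

theorem eventually_ne_zero_of_dominant {ι α : Type*} {l : Filter α} {f : ι → α → ℂ}
    {m : ι → α → ℝ} {s : Finset ι} (hfm : ∀ i ∈ s, f i =Θ[l] m i) {i : ι} (hi : i ∈ s)
    (hdom : ∀ j ∈ s, j ≠ i → m j =o[l] m i) (hne : ∀ᶠ t in l, m i t ≠ 0) :
    ∀ᶠ t in l, ∑ j ∈ s, f j t ≠ 0 := by
  have h1 : (fun t => ∑ j ∈ s.erase i, f j t) =o[l] f i := by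
    refine Asymptotics.IsLittleO.fun_sum fun j hj => ?_
    have h1 : f j =O[l] m j := (hfm j (Finset.mem_of_mem_erase hj)).1
    have h2 : m j =o[l] m i := hdom j (Finset.mem_of_mem_erase hj) (Finset.ne_of_mem_erase hj)
    have h3 : m i =O[l] f i := (hfm i hi).2
    exact (h1.trans_isLittleO h2).trans_isBigO h3
  filter_upwards [h1.def (show (0 : ℝ) < 1 / 2 by norm_num), (hfm i hi).eq_zero_iff, hne]
    with t ht h0 hmt hsum
  have hft : f i t ≠ 0 := fun h => hmt (h0.mp h)
  rw [← Finset.add_sum_erase _ _ hi] at hsum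
  rw [eq_neg_of_add_eq_zero_right hsum, norm_neg] at ht
  have := norm_pos_iff.mpr hft
  linarith

theorem rpow_neg_mul_eq_iff {t h c q : ℝ} (ht : 0 < t) : t ^ (-q) * h = c ↔ h = c * t ^ q := by
  have := Real.rpow_pos_of_pos ht q
  rw [Real.rpow_neg ht.le]
  field_simp

/-- The leading asymptotics of a positive algebraic function at an endpoint: it is equivalent to
a positive multiple of a rational power. -/
theorem exists_tendsto_rpow_mul_of_algebraic {h : ℝ → ℝ} {r : ℝ} (hr : 0 < r)
    (hcont : ContinuousOn h (Set.Ioo 0 r)) (hpos : ∀ t ∈ Set.Ioo 0 r, 0 < h t)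
    {P : Polynomial (Polynomial ℂ)} (hP : P ≠ 0)
    (halg : ∀ t ∈ Set.Ioo 0 r, (P.map (Polynomial.evalRingHom (t : ℂ))).eval (h t : ℂ) = 0) :
    ∃ q : ℚ, ∃ L : ℝ, 0 < L ∧
      Tendsto (fun t : ℝ => t ^ (-(q : ℝ)) * h t) (𝓝[>] 0) (𝓝 L) := by
  have hr' : Set.Ioo 0 r ∈ 𝓝[>] (0 : ℝ) := Ioo_mem_nhdsGT hr
  have hsum : ∀ t ∈ Set.Ioo 0 r,
      ∑ i ∈ P.support, (P.coeff i).eval (t : ℂ) * (h t : ℂ) ^ i = 0 := by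
    intro t ht
    rw [← halg t ht, Polynomial.eval_map, Polynomial.eval₂_eq_sum, Polynomial.sum_def]
    simp
  have hex : ∀ i, ∃ e : ℕ, ∃ c : ℂ, i ∈ P.support → c ≠ 0 ∧
      Tendsto (fun t : ℝ => (P.coeff i).eval (t : ℂ) / (t : ℂ) ^ e) (𝓝[>] 0) (𝓝 c) := by
    intro i
    by_cases hi : i ∈ P.support
    · obtain ⟨e, c, hc⟩ := exists_tendsto_eval_div_pow (Polynomial.mem_support_iff.mp hi)
      exact ⟨e, c, fun _ => hc⟩
    · exact ⟨0, 0, fun h => absurd h hi⟩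
  choose e c hec using hex
  have hcoeff : ∀ (i : ℕ) {t : ℝ}, 0 < t →
      (P.coeff i).eval (t : ℂ) = (P.coeff i).eval (t : ℂ) / (t : ℂ) ^ e i * (t : ℂ) ^ e i := by
    intro i t ht
    have : (t : ℂ) ≠ 0 := by exact_mod_cast ht.ne'
    field_simp
  have hsupp : P.support.Nonempty := Polynomial.support_nonempty.mpr hP
  have hlim : ∀ q : ℚ, Tendsto (fun t : ℝ => t ^ (-(q : ℝ)) * h t) (𝓝[>] 0) atTop ∨
      ∃ L, 0 ≤ L ∧ Tendsto (fun t : ℝ => t ^ (-(q : ℝ)) * h t) (𝓝[>] 0) (𝓝 L) := by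
    intro q
    obtain ⟨k, hk, hkmin⟩ := P.support.exists_min_image (fun i => (e i : ℝ) + q * i) hsupp
    set Q : Polynomial ℂ := ∑ i ∈ P.support,
      if (e i : ℝ) + q * i = e k + q * k then Polynomial.C (c i) * Polynomial.X ^ i else 0 with hQ
    have hQ0 : Q ≠ 0 := by
      intro h0
      have : Q.coeff k = c k := by
        rw [hQ, Polynomial.finsetSum_coeff, Finset.sum_eq_single_of_mem k hk]
        · simp
        · intro i _ hik
          split_ifs
          · rw [Polynomial.coeff_C_mul_X_pow, if_neg (Ne.symm hik)]
          · simp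
      rw [h0, Polynomial.coeff_zero] at this
      exact (hec k hk).1 this.symm
    have hE : {x : ℝ | Q.eval (x : ℂ) = 0}.Finite := by
      have := Polynomial.finite_setOfPred_isRoot hQ0
      exact this.preimage Complex.ofReal_injective.injOn
    refine tendsto_nhds_or_atTop_of_eventually_lt_or_gt hE ?_ fun a ha haE => ?_
    · filter_upwards [hr'] with t ht
      exact mul_pos (Real.rpow_pos_of_pos ht.1 _) (hpos t ht)
    refine eventually_lt_or_gt_of_eventually_ne hr (ContinuousOn.mul ?_ hcont) ?_
    · exact continuousOn_id.rpow_const fun t ht => Or.inl ht.1.ne'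
    have ht : Tendsto (fun t : ℝ => ∑ i ∈ P.support, (P.coeff i).eval (t : ℂ) / (t : ℂ) ^ e i *
        (a : ℂ) ^ i * ((t ^ ((e i : ℝ) + q * i - (e k + q * k)) : ℝ) : ℂ)) (𝓝[>] 0)
        (𝓝 (Q.eval (a : ℂ))) := by
      rw [hQ, Polynomial.eval_finsetSum]
      refine tendsto_finsetSum _ fun i hi => ?_
      have h1 := (hec i hi).2.mul_const ((a : ℂ) ^ i)
      split_ifs with hik
      · rw [hik]
        simpa using h1
      · have hpos' : 0 < (e i : ℝ) + q * i - (e k + q * k) :=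
          sub_pos.mpr (lt_of_le_of_ne (hkmin i hi) (Ne.symm hik))
        have h2 : Tendsto (fun t : ℝ => t ^ ((e i : ℝ) + q * i - (e k + q * k)))
            (𝓝[>] 0) (𝓝 0) := by
          have := (Real.continuousAt_rpow_const 0 _ (Or.inr hpos'.le)).tendsto
          rw [Real.zero_rpow hpos'.ne'] at this
          exact this.mono_left nhdsWithin_le_nhds
        have h3 := h1.mul ((Complex.continuous_ofReal.tendsto 0).comp h2)
        simpa using h3
    filter_upwards [ht.eventually_ne haE, hr'] with t htne htr hcon
    rw [rpow_neg_mul_eq_iff htr.1] at hcon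
    apply htne
    have hs := hsum t htr
    have hfac : ∑ i ∈ P.support, (P.coeff i).eval (t : ℂ) * (h t : ℂ) ^ i
        = ((t ^ ((e k : ℝ) + q * k) : ℝ) : ℂ) *
          ∑ i ∈ P.support, (P.coeff i).eval (t : ℂ) / (t : ℂ) ^ e i *
        (a : ℂ) ^ i * ((t ^ ((e i : ℝ) + q * i - (e k + q * k)) : ℝ) : ℂ) := by
      rw [Finset.mul_sum]
      refine Finset.sum_congr rfl fun i _ => ?_
      have h1 : t ^ ((e k : ℝ) + q * k) * t ^ ((e i : ℝ) + q * i - (e k + q * k))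
          = t ^ e i * (t ^ (q : ℝ)) ^ i := by
        rw [← Real.rpow_add htr.1, ← Real.rpow_natCast t (e i), ← Real.rpow_natCast (t ^ (q : ℝ)),
          ← Real.rpow_mul htr.1.le, ← Real.rpow_add htr.1]
        congr 1
        ring
      have h2 := congrArg (fun x : ℝ => (x : ℂ)) h1
      push_cast at h2
      conv_lhs => rw [hcoeff i htr.1, hcon]
      push_cast
      rw [mul_pow]
      linear_combination (-(P.coeff i).eval (t : ℂ) / (t : ℂ) ^ e i * (a : ℂ) ^ i) * h2
    rw [hs] at hfac
    refine (mul_eq_zero.mp hfac.symm).resolve_left ?_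
    exact_mod_cast (Real.rpow_pos_of_pos htr.1 _).ne'
  by_contra hcon
  push Not at hcon
  set m : ℕ → ℝ → ℝ := fun i t => t ^ e i * h t ^ i with hm
  have hmpos : ∀ i, ∀ t ∈ Set.Ioo 0 r, 0 < m i t := fun i t ht =>
    mul_pos (pow_pos ht.1 _) (pow_pos (hpos t ht) _)
  have hcomp : ∀ i j, i < j → m i =o[𝓝[>] 0] m j ∨ m j =o[𝓝[>] 0] m i := by
    intro i j hij
    set q : ℚ := ((e i : ℚ) - e j) / ((j - i : ℕ) : ℚ) with hq
    have hji : (0 : ℝ) < ((j - i : ℕ) : ℝ) := by exact_mod_cast Nat.sub_pos_of_lt hij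
    set φ : ℝ → ℝ := fun t => t ^ (-(q : ℝ)) * h t with hφ
    have hrel : ∀ t ∈ Set.Ioo 0 r, m j t = φ t ^ (j - i) * m i t := by
      intro t ht
      have h1 : (t ^ (-(q : ℝ))) ^ (j - i) * t ^ e i = t ^ e j := by
        rw [← Real.rpow_natCast (t ^ (-(q : ℝ))), ← Real.rpow_mul ht.1.le,
          ← Real.rpow_natCast t (e i), ← Real.rpow_add ht.1, ← Real.rpow_natCast t (e j)]
        congr 1
        rw [hq]
        push_cast
        field_simp
        ring
      have h2 : h t ^ (j - i) * h t ^ i = h t ^ j := by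
        rw [← pow_add, Nat.sub_add_cancel hij.le]
      simp only [hm, hφ, mul_pow]
      rw [← h1, ← h2]
      ring
    have hφpos : ∀ t ∈ Set.Ioo 0 r, 0 < φ t := fun t ht =>
      mul_pos (Real.rpow_pos_of_pos ht.1 _) (hpos t ht)
    have hne : j - i ≠ 0 := (Nat.sub_pos_of_lt hij).ne'
    rcases hlim q with hq' | ⟨L, hL0, hL⟩
    · left
      have h1 : Tendsto (fun t => (φ t ^ (j - i))⁻¹) (𝓝[>] 0) (𝓝 0) :=
        ((tendsto_pow_atTop hne).comp hq').inv_tendsto_atTop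
      have h2 := ((Asymptotics.isLittleO_one_iff ℝ).mpr h1).mul_isBigO
        (Asymptotics.isBigO_refl (m j) (𝓝[>] 0))
      refine h2.congr' ?_ (by simp)
      filter_upwards [hr'] with t ht
      have := hφpos t ht
      rw [hrel t ht]
      field_simp
    · right
      have hL0' : L = 0 := by
        by_contra hne'
        exact hcon q L (lt_of_le_of_ne hL0 (Ne.symm hne')) hL
      rw [hL0'] at hL
      have h1 : Tendsto (fun t => φ t ^ (j - i)) (𝓝[>] 0) (𝓝 0) := by
        simpa [hne] using hL.pow (j - i)
      have h2 := ((Asymptotics.isLittleO_one_iff ℝ).mpr h1).mul_isBigO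
        (Asymptotics.isBigO_refl (m i) (𝓝[>] 0))
      refine h2.congr' ?_ (by simp)
      filter_upwards [hr'] with t ht
      exact (hrel t ht).symm
  obtain ⟨k, hk, hdom⟩ := exists_forall_isLittleO_of_pairwise (l := 𝓝[>] (0 : ℝ)) (f := m)
    P.support hsupp fun i _ j _ hij => by
      rcases lt_or_gt_of_ne hij with h' | h'
      · exact hcomp i j h'
      · exact (hcomp j i h').symm
  have hΘ : ∀ i ∈ P.support,
      (fun t : ℝ => (P.coeff i).eval (t : ℂ) * (h t : ℂ) ^ i) =Θ[𝓝[>] 0] m i := by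
    intro i hi
    have h1 : (fun t : ℝ => (P.coeff i).eval (t : ℂ) * (h t : ℂ) ^ i) =Θ[𝓝[>] 0]
        fun t => ((m i t : ℝ) : ℂ) := by
      refine (Asymptotics.isTheta_of_div_tendsto_nhds_ne_zero (c := c i)
        ((hec i hi).2.congr' ?_) (hec i hi).1).symm
      filter_upwards [hr'] with t ht
      have h2 : (h t : ℂ) ≠ 0 := by exact_mod_cast (hpos t ht).ne'
      have h3 : (t : ℂ) ≠ 0 := by exact_mod_cast ht.1.ne'
      simp only [hm]
      push_cast
      field_simp
    exact h1.trans (Asymptotics.IsTheta.of_norm_eventuallyEq_norm (by simp))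
  have := eventually_ne_zero_of_dominant hΘ hk hdom
    (mem_of_superset hr' fun t ht => (hmpos k t ht).ne')
  obtain ⟨t, ht, htr⟩ := (this.and hr').exists
  exact ht (hsum t htr)

/-- The boundary value at a real point of the Stieltjes transform on the upper half-plane. -/
def stieltjesBoundary (μ : Measure ℝ) (x : ℝ) : ℂ :=
  limUnder (𝓝[{z : ℂ | 0 < z.im}] (x : ℂ)) (stieltjes μ)

/-- The density furnished by the Stieltjes inversion formula. -/
def stieltjesDensity (μ : Measure ℝ) (x : ℝ) : ℝ := -(stieltjesBoundary μ x).im / Real.pi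

theorem nhdsWithin_im_pos_neBot (x : ℝ) : (𝓝[{z : ℂ | 0 < z.im}] (x : ℂ)).NeBot := by
  have h : Tendsto (fun ε : ℝ => (x : ℂ) + ε * Complex.I) (𝓝[>] 0)
      (𝓝[{z : ℂ | 0 < z.im}] (x : ℂ)) := by
    refine tendsto_nhdsWithin_iff.mpr ⟨?_, ?_⟩
    · have : Continuous fun ε : ℝ => (x : ℂ) + ε * Complex.I := by fun_prop
      simpa using (this.tendsto 0).mono_left nhdsWithin_le_nhds
    · filter_upwards [self_mem_nhdsWithin] with ε hε
      simpa using hε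
  exact h.neBot

theorem stieltjesBoundary_eq {μ : Measure ℝ} {x : ℝ} {y : ℂ}
    (h : Tendsto (stieltjes μ) (𝓝[{z : ℂ | 0 < z.im}] (x : ℂ)) (𝓝 y)) :
    stieltjesBoundary μ x = y :=
  have := nhdsWithin_im_pos_neBot x
  h.limUnder_eq

section Algebraic

variable {μ : Measure ℝ} [IsFiniteMeasure μ] {F : Polynomial (Polynomial ℂ)} {x : ℝ}

theorem eval_stieltjesBoundary_eq_zero (hx : (x : ℂ) ∉ badSet F)
    (hFS : ∀ z : ℂ, 0 < z.im →
      (F.map (Polynomial.evalRingHom z)).eval (stieltjes μ z) = 0) :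
    (F.map (Polynomial.evalRingHom (x : ℂ))).eval (stieltjesBoundary μ x) = 0 := by
  simp only [badSet, Set.mem_ofPred_eq, Polynomial.eval_mul, mul_eq_zero, not_or] at hx
  obtain ⟨y, hy, hlim⟩ := exists_tendsto_root hx.1 (continuousOn_stieltjes μ) hFS
  rwa [stieltjesBoundary_eq hlim]

theorem exists_ball_extension (hF : F.natDegree ≠ 0) (hx : (x : ℂ) ∉ badSet F)
    (hFS : ∀ z : ℂ, 0 < z.im →
      (F.map (Polynomial.evalRingHom z)).eval (stieltjes μ z) = 0) :
    ∃ δ > 0, ∃ (g : ℂ → ℂ) (M : ℝ), AnalyticOnNhd ℂ g (Metric.ball (x : ℂ) δ) ∧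
      (∀ z ∈ Metric.ball (x : ℂ) δ, ‖g z‖ ≤ M) ∧
      (∀ z ∈ Metric.ball (x : ℂ) δ, 0 < z.im → stieltjes μ z = g z) ∧
      ∀ y ∈ Set.Ioo (x - δ) (x + δ), stieltjesBoundary μ y = g y := by
  obtain ⟨g, hg, hSg⟩ := exists_analyticAt_extension hF hx (continuousOn_stieltjes μ) hFS
  have hM : ∀ᶠ z in 𝓝 (x : ℂ), ‖g z‖ < ‖g x‖ + 1 :=
    hg.continuousAt.norm.eventually_lt_const (lt_add_one _)
  obtain ⟨δ, hδ, hball⟩ := Metric.eventually_nhds_iff_ball.mp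
    (hg.eventually_analyticAt.and (hSg.and hM))
  refine ⟨δ, hδ, g, ‖g x‖ + 1, fun z hz => (hball z hz).1, fun z hz => (hball z hz).2.2.le,
    fun z hz => (hball z hz).2.1, fun y hy => stieltjesBoundary_eq ?_⟩
  have hyb : (y : ℂ) ∈ Metric.ball (x : ℂ) δ := ofReal_mem_ball hy
  refine ((hball y hyb).1.continuousAt.tendsto.mono_left nhdsWithin_le_nhds).congr' ?_
  filter_upwards [self_mem_nhdsWithin,
    nhdsWithin_le_nhds (Metric.isOpen_ball.mem_nhds hyb)] with z hz hzb
  exact ((hball z hzb).2.1 hz).symm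

theorem analyticAt_stieltjesDensity (hF : F.natDegree ≠ 0) (hx : (x : ℂ) ∉ badSet F)
    (hFS : ∀ z : ℂ, 0 < z.im →
      (F.map (Polynomial.evalRingHom z)).eval (stieltjes μ z) = 0) :
    AnalyticAt ℝ (stieltjesDensity μ) x := by
  obtain ⟨δ, hδ, g, M, hg, -, -, hGg⟩ := exists_ball_extension hF hx hFS
  have h1 : AnalyticAt ℝ g (x : ℂ) := (hg x (Metric.mem_ball_self hδ)).restrictScalars
  have h2 : AnalyticAt ℝ (fun y : ℝ => g y) x :=
    h1.comp (Complex.ofRealCLM.analyticAt x)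
  have h3 : AnalyticAt ℝ (fun y : ℝ => (g y).im) x :=
    (Complex.imCLM.analyticAt _).comp h2
  refine (h3.neg.div_const (c := Real.pi)).congr ?_
  filter_upwards [Ioo_mem_nhds (sub_lt_self x hδ) (lt_add_of_pos_right x hδ)] with y hy
  simp [stieltjesDensity, hGg y hy]

theorem stieltjesDensity_nonneg (hF : F.natDegree ≠ 0) (hx : (x : ℂ) ∉ badSet F)
    (hFS : ∀ z : ℂ, 0 < z.im →
      (F.map (Polynomial.evalRingHom z)).eval (stieltjes μ z) = 0) :
    0 ≤ stieltjesDensity μ x := by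
  obtain ⟨δ, hδ, g, M, hg, -, hSg, hGg⟩ := exists_ball_extension hF hx hFS
  have hx' : x ∈ Set.Ioo (x - δ) (x + δ) := ⟨sub_lt_self x hδ, lt_add_of_pos_right x hδ⟩
  rw [stieltjesDensity, hGg x hx']
  exact div_nonneg (extension_neg_im_nonneg μ hg.continuousOn hSg hx') Real.pi_pos.le

theorem restrict_eq_withDensity_stieltjesDensity (hF : F.natDegree ≠ 0) {I : Set ℝ}
    (hIo : IsOpen I) (hI : ∀ x ∈ I, (x : ℂ) ∉ badSet F)
    (hFS : ∀ z : ℂ, 0 < z.im →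
      (F.map (Polynomial.evalRingHom z)).eval (stieltjes μ z) = 0) :
    μ.restrict I =
      (volume.restrict I).withDensity fun x => ENNReal.ofReal (stieltjesDensity μ x) := by
  have hloc : ∀ x ∈ I, ∃ s : Set ℝ, s ∈ 𝓝 x ∧ s ⊆ I ∧ MeasurableSet s ∧ μ.restrict s =
      (volume.withDensity fun x => ENNReal.ofReal (stieltjesDensity μ x)).restrict s := by
    intro x hx
    obtain ⟨δ, hδ, g, M, hg, hM, hSg, hGg⟩ := exists_ball_extension hF (hI x hx) hFS
    obtain ⟨η, hη, hηI⟩ := Metric.isOpen_iff.mp hIo x hx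
    rw [Real.ball_eq_Ioo] at hηI
    have hpos : 0 < min δ η := lt_min hδ hη
    have h1 := min_le_left δ η
    have h2 := min_le_right δ η
    refine ⟨Set.Ioc (x - min δ η / 2) (x + min δ η / 2),
      Ioc_mem_nhds (by linarith) (by linarith),
      fun y hy => hηI ⟨by linarith [hy.1], by linarith [hy.2]⟩, measurableSet_Ioc, ?_⟩
    rw [restrict_Ioc_eq_withDensity_of_extension μ hg.continuousOn hM hSg
      (by linarith) (by linarith), restrict_withDensity measurableSet_Ioc,
      restrict_withDensity measurableSet_Ioc]
    refine withDensity_congr_ae ?_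
    filter_upwards [ae_restrict_mem measurableSet_Ioc] with y hy
    rw [stieltjesDensity, hGg y ⟨by linarith [hy.1], by linarith [hy.2]⟩]
  rw [← restrict_withDensity hIo.measurableSet]
  choose! s hs using hloc
  obtain ⟨t, htI, htc, hcover⟩ := TopologicalSpace.countable_cover_nhdsWithin
    fun x hx => mem_nhdsWithin_of_mem_nhds (hs x hx).1
  have hIt : I = ⋃ x ∈ t, s x :=
    hcover.antisymm (Set.iUnion₂_subset fun x hx => (hs x (htI hx)).2.1)
  rw [hIt, Measure.restrict_biUnion_congr htc]
  exact fun x hx => (hs x (htI hx)).2.2.2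

end Algebraic

theorem exists_polynomial_im_of_algebraic {T : Set ℝ} {G : ℝ → ℂ}
    {F : Polynomial (Polynomial ℂ)} (hF : F ≠ 0)
    (h : ∀ x ∈ T, (F.map (Polynomial.evalRingHom (x : ℂ))).eval (G x) = 0) :
    ∃ P : Polynomial (Polynomial ℂ), P ≠ 0 ∧ ∀ x ∈ T,
      (P.map (Polynomial.evalRingHom (x : ℂ))).eval ((-(G x).im / Real.pi : ℝ) : ℂ) = 0 := by
  let φ : Polynomial ℂ →+* (T → ℂ) :=
    RingHom.pi fun x : T => Polynomial.evalRingHom ((x : ℝ) : ℂ)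
  let : Algebra (Polynomial ℂ) (T → ℂ) := φ.toAlgebra
  have haeval : ∀ (s : T → ℂ) (p : Polynomial (Polynomial ℂ)) (x : T),
      Polynomial.aeval s p x = (p.map (Polynomial.evalRingHom ((x : ℝ) : ℂ))).eval (s x) := by
    intro s p x
    rw [Polynomial.eval_map, Polynomial.aeval_def,
      ← Pi.evalRingHom_apply (fun _ : T => ℂ) x (Polynomial.eval₂ _ s p), Polynomial.hom_eval₂]
    rfl
  have hG : IsAlgebraic (Polynomial ℂ) fun x : T => G x :=
    ⟨F, hF, funext fun x => by rw [haeval]; exact h x x.2⟩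
  have hconj : IsAlgebraic (Polynomial ℂ) fun x : T => (starRingEnd ℂ) (G x) := by
    refine ⟨F.map (Polynomial.mapRingHom (starRingEnd ℂ)), ?_, funext fun x => ?_⟩
    · rw [Ne, Polynomial.map_eq_zero_iff]
      · exact hF
      · exact Polynomial.map_injective _ (starRingEnd ℂ).injective
    · rw [haeval, Polynomial.map_map, Pi.zero_apply]
      have hcomp : (Polynomial.evalRingHom ((x : ℝ) : ℂ)).comp
          (Polynomial.mapRingHom (starRingEnd ℂ)) =
          (starRingEnd ℂ).comp (Polynomial.evalRingHom ((x : ℝ) : ℂ)) := by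
        ext <;> simp
      rw [hcomp, ← Polynomial.map_map, Polynomial.eval_map_apply, h x x.2, map_zero]
  have hc : IsAlgebraic (Polynomial ℂ) fun _ : T => Complex.I / (2 * Real.pi) := by
    have := isAlgebraic_algebraMap (R := Polynomial ℂ) (A := T → ℂ)
      (Polynomial.C (Complex.I / (2 * Real.pi)))
    convert this using 1
    funext x
    exact (Polynomial.eval_C ..).symm
  obtain ⟨P, hP, hP0⟩ := hc.mul (hG.sub hconj)
  refine ⟨P, hP, fun x hx => ?_⟩
  have := congrFun hP0 ⟨x, hx⟩
  rw [haeval, Pi.zero_apply] at this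
  convert this using 2
  simp only [Pi.mul_apply, Pi.sub_apply, Complex.sub_conj]
  push_cast
  have hpi : (Real.pi : ℂ) ≠ 0 := by exact_mod_cast Real.pi_ne_zero
  field_simp
  linear_combination (-((G x).im : ℂ)) * Complex.I_sq

theorem exists_tendsto_rpow_one_sub_mul_of_algebraic {h : ℝ → ℝ} {r : ℝ} (hr : 0 < r)
    (hcont : ContinuousOn h (Set.Ioo 0 r)) (hnonneg : ∀ t ∈ Set.Ioo 0 r, 0 ≤ h t)
    (hInt : IntegrableOn h (Set.Ioo 0 r))
    {P : Polynomial (Polynomial ℂ)} (hP : P.coeff 0 ≠ 0)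
    (halg : ∀ t ∈ Set.Ioo 0 r, (P.map (Polynomial.evalRingHom (t : ℂ))).eval (h t : ℂ) = 0) :
    ∃ c : ℚ, 0 < c ∧ ∃ L : ℝ, 0 < L ∧
      Tendsto (fun t : ℝ => t ^ ((1 : ℝ) - c) * h t) (𝓝[>] 0) (𝓝 L) := by
  have hZ : {t : ℝ | (P.coeff 0).eval (t : ℂ) = 0}.Finite :=
    (Polynomial.finite_setOfPred_isRoot hP).preimage Complex.ofReal_injective.injOn
  have hne : ∀ᶠ t : ℝ in 𝓝[>] 0, (P.coeff 0).eval (t : ℂ) ≠ 0 := by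
    have : ∀ᶠ t : ℝ in 𝓝 0, t ∉ {t : ℝ | (P.coeff 0).eval (t : ℂ) = 0} \ {0} :=
      (hZ.subset Set.sdiff_subset).isClosed.isOpen_compl.mem_nhds (by simp)
    filter_upwards [nhdsWithin_le_nhds this, self_mem_nhdsWithin] with t ht ht0 h0
    exact ht ⟨h0, ne_of_gt ht0⟩
  obtain ⟨s, hs, hsub⟩ := (mem_nhdsGT_iff_exists_Ioo_subset' (one_pos : (0:ℝ) < 1)).mp
    (hne.and (Ioo_mem_nhdsGT hr))
  have hpos : ∀ t ∈ Set.Ioo 0 s, 0 < h t := by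
    intro t ht
    refine lt_of_le_of_ne (hnonneg t (hsub ht).2) fun h0 => (hsub ht).1 ?_
    have := halg t (hsub ht).2
    rwa [← h0, Complex.ofReal_zero, ← Polynomial.coeff_zero_eq_eval_zero,
      Polynomial.coeff_map] at this
  obtain ⟨q, L, hL, hlim⟩ := exists_tendsto_rpow_mul_of_algebraic hs
    (hcont.mono fun t ht => (hsub ht).2) hpos (P := P) (by rintro rfl; simp at hP)
    fun t ht => halg t (hsub ht).2
  refine ⟨1 + q, ?_, L, hL, by simpa using hlim⟩
  obtain ⟨u, hu, husub⟩ := (mem_nhdsGT_iff_exists_Ioo_subset' (one_pos : (0:ℝ) < 1)).mp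
    ((hlim.eventually_const_lt (half_lt_self hL)).and (Ioo_mem_nhdsGT hr))
  have hhu : IntegrableOn h (Set.Ioo 0 u) := hInt.mono_set fun t ht => (husub ht).2
  have hqu : IntegrableOn (fun t : ℝ => t ^ (q : ℝ)) (Set.Ioo 0 u) := by
    refine (hhu.const_mul (2 / L)).mono' ?_ ?_
    · exact (measurable_id.pow_const (q : ℝ)).aestronglyMeasurable
    · filter_upwards [ae_restrict_mem measurableSet_Ioo] with t ht
      have ht' : L / 2 < t ^ (-(q : ℝ)) * h t := (husub ht).1
      have htq := Real.rpow_pos_of_pos ht.1 (q : ℝ)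
      rw [Real.norm_of_nonneg htq.le]
      rw [Real.rpow_neg ht.1.le, inv_mul_eq_div, lt_div_iff₀ htq] at ht'
      rw [div_mul_eq_mul_div, le_div_iff₀ hL]
      linarith
  have := (intervalIntegral.integrableOn_Ioo_rpow_iff hu).mp hqu
  have hq : (-1 : ℚ) < q := by exact_mod_cast this
  linarith

theorem exists_tendsto_rpow_one_sub_mul_comp {h φ : ℝ → ℝ} {a b r : ℝ} (hr : 0 < r)
    (hcont : ContinuousOn h (Set.Ioo a b)) (hnonneg : ∀ t ∈ Set.Ioo a b, 0 ≤ h t)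
    (hInt : IntegrableOn h (Set.Ioo a b))
    {P : Polynomial (Polynomial ℂ)} (hP : P.coeff 0 ≠ 0)
    (halg : ∀ t ∈ Set.Ioo a b, (P.map (Polynomial.evalRingHom (t : ℂ))).eval (h t : ℂ) = 0)
    (hφc : Continuous φ) (hφ : MeasurePreserving φ) (hemb : MeasurableEmbedding φ)
    (hpre : φ ⁻¹' Set.Ioo a b = Set.Ioo 0 r) {p : Polynomial ℂ} (hp : p.natDegree ≠ 0)
    (hpφ : ∀ t : ℝ, p.eval (t : ℂ) = φ t) :
    ∃ c : ℚ, 0 < c ∧ ∃ L : ℝ, 0 < L ∧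
      Tendsto (fun t : ℝ => t ^ ((1 : ℝ) - c) * h (φ t)) (𝓝[>] 0) (𝓝 L) := by
  have hmaps : ∀ t ∈ Set.Ioo 0 r, φ t ∈ Set.Ioo a b := fun t ht => by rwa [← hpre] at ht
  refine exists_tendsto_rpow_one_sub_mul_of_algebraic (h := fun t => h (φ t))
    (P := P.map (Polynomial.compRingHom p)) hr
    (hcont.comp hφc.continuousOn hmaps) (fun t ht => hnonneg _ (hmaps t ht)) ?_ ?_ ?_
  · rw [← hpre]
    exact (hφ.integrableOn_comp_preimage hemb).mpr hInt
  · rw [Polynomial.coeff_map, Polynomial.coe_compRingHom_apply, Ne, Polynomial.comp_eq_zero_iff]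
    rintro (h0 | ⟨-, h0⟩)
    · exact hP h0
    · exact hp (by rw [h0, Polynomial.natDegree_C])
  · intro t ht
    have hcomp : (Polynomial.evalRingHom (t : ℂ)).comp (Polynomial.compRingHom p) =
        Polynomial.evalRingHom (φ t : ℂ) := by
      ext <;> simp [hpφ]
    rw [Polynomial.map_map, hcomp]
    exact halg _ (hmaps t ht)

/-- A nonnegative, analytic, integrable algebraic function behaves at both endpoints like a power
with rational exponent greater than `-1`. -/
theorem rationalBetaType_of_algebraic {h : ℝ → ℝ} {a b : ℝ} (hab : a < b)
    (han : AnalyticOnNhd ℝ h (Set.Ioo a b)) (hnonneg : ∀ t ∈ Set.Ioo a b, 0 ≤ h t)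
    (hInt : IntegrableOn h (Set.Ioo a b))
    {P : Polynomial (Polynomial ℂ)} (hP : P.coeff 0 ≠ 0)
    (halg : ∀ t ∈ Set.Ioo a b, (P.map (Polynomial.evalRingHom (t : ℂ))).eval (h t : ℂ) = 0) :
    RationalBetaType h a b := by
  refine ⟨hab, han, hnonneg, ?_, ?_⟩
  · obtain ⟨c, hc, L, hL, hlim⟩ := exists_tendsto_rpow_one_sub_mul_comp
      (φ := fun t => a + t) (p := Polynomial.X + Polynomial.C (a : ℂ)) (sub_pos.mpr hab)
      han.continuousOn hnonneg hInt hP halg (by fun_prop) (measurePreserving_add_left volume a)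
      (measurableEmbedding_addLeft a) (by ext t; simp [lt_sub_iff_add_lt'])
      (by rw [Polynomial.natDegree_X_add_C]; exact one_ne_zero)
      fun t => by simp [add_comm]
    refine ⟨c, hc, L, hL, ?_⟩
    have hsub : Tendsto (fun x : ℝ => x - a) (𝓝[>] a) (𝓝[>] 0) := by
      refine tendsto_nhdsWithin_iff.mpr ⟨?_, ?_⟩
      · have : Continuous fun x : ℝ => x - a := by fun_prop
        simpa using (this.tendsto a).mono_left nhdsWithin_le_nhds
      · filter_upwards [self_mem_nhdsWithin] with x hx
        exact sub_pos.mpr (Set.mem_Ioi.mp hx)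
    simpa [Function.comp_def] using hlim.comp hsub
  · obtain ⟨c, hc, L, hL, hlim⟩ := exists_tendsto_rpow_one_sub_mul_comp
      (φ := fun t => b - t) (p := -Polynomial.X + Polynomial.C (b : ℂ)) (sub_pos.mpr hab)
      han.continuousOn hnonneg hInt hP halg (by fun_prop) (Measure.measurePreserving_sub_left volume b)
      (MeasurableEquiv.subLeft b).measurableEmbedding
      (by ext t; simp [lt_sub_comm, and_comm])
      (by rw [Polynomial.natDegree_add_C, Polynomial.natDegree_neg, Polynomial.natDegree_X]
          exact one_ne_zero)
      fun t => by simp; ring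
    refine ⟨c, hc, L, hL, ?_⟩
    have hsub : Tendsto (fun x : ℝ => b - x) (𝓝[<] b) (𝓝[>] 0) := by
      refine tendsto_nhdsWithin_iff.mpr ⟨?_, ?_⟩
      · have : Continuous fun x : ℝ => b - x := by fun_prop
        simpa using (this.tendsto b).mono_left nhdsWithin_le_nhds
      · filter_upwards [self_mem_nhdsWithin] with x hx
        exact sub_pos.mpr (Set.mem_Iio.mp hx)
    simpa [Function.comp_def] using hlim.comp hsub

/-- An algebraic relation for a nonzero analytic function can be chosen with nonzero constant
term. -/
theorem exists_polynomial_coeff_zero_ne_zero {h : ℝ → ℝ} {I : Set ℝ} (hIo : IsOpen I)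
    (hI : IsPreconnected I)
    (han : AnalyticOnNhd ℝ h I) (hh : ¬ Set.EqOn h 0 I)
    {P : Polynomial (Polynomial ℂ)} (hP : P ≠ 0)
    (halg : ∀ t ∈ I, (P.map (Polynomial.evalRingHom (t : ℂ))).eval (h t : ℂ) = 0) :
    ∃ Q : Polynomial (Polynomial ℂ), Q.coeff 0 ≠ 0 ∧
      ∀ t ∈ I, (Q.map (Polynomial.evalRingHom (t : ℂ))).eval (h t : ℂ) = 0 := by
  obtain ⟨n, Q, hPQ, hdvd⟩ : ∃ (n : ℕ) (Q : Polynomial (Polynomial ℂ)),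
      P = (Polynomial.X - Polynomial.C 0) ^ n * Q ∧ ¬ Polynomial.X - Polynomial.C 0 ∣ Q :=
    ⟨_, Polynomial.exists_eq_pow_rootMultiplicity_mul_and_not_dvd P hP 0⟩
  rw [Polynomial.C_0, sub_zero] at hPQ hdvd
  refine ⟨Q, fun h0 => hdvd (Polynomial.X_dvd_iff.mpr h0), fun x hx => ?_⟩
  have key : ∀ t : ℝ, (P.map (Polynomial.evalRingHom (t : ℂ))).eval (h t : ℂ) = 0 → h t ≠ 0 →
      (Q.map (Polynomial.evalRingHom (t : ℂ))).eval (h t : ℂ) = 0 := by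
    intro t ht hne
    rw [hPQ, Polynomial.map_mul, Polynomial.map_pow, Polynomial.map_X, Polynomial.eval_mul,
      Polynomial.eval_pow, Polynomial.eval_X] at ht
    exact (mul_eq_zero.mp ht).resolve_left (pow_ne_zero n (by exact_mod_cast hne))
  rcases (han x hx).eventually_eq_zero_or_eventually_ne_zero with h0 | hne
  · exact absurd (han.eqOn_zero_of_preconnected_of_eventuallyEq_zero hI hx h0) hh
  · have hlim : Tendsto (fun t : ℝ => (Q.map (Polynomial.evalRingHom (t : ℂ))).eval (h t : ℂ))
        (𝓝[≠] x) (𝓝 ((Q.map (Polynomial.evalRingHom (x : ℂ))).eval (h x : ℂ))) := by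
      have h1 : ContinuousAt (fun t : ℝ => ((t : ℂ), (h t : ℂ))) x :=
        Complex.continuous_ofReal.continuousAt.prodMk
          (Complex.continuous_ofReal.continuousAt.comp (han x hx).continuousAt)
      exact ((contDiff_eval_map_evalRingHom Q).continuous.continuousAt.comp h1).tendsto.mono_left
        nhdsWithin_le_nhds
    refine tendsto_nhds_unique (hlim.congr' ?_) tendsto_const_nhds
    filter_upwards [hne, nhdsWithin_le_nhds (hIo.mem_nhds hx)] with t ht htI
    exact key t (halg t htI) ht

theorem natDegree_ne_zero_of_eval_eq_zero {F : Polynomial (Polynomial ℂ)} (hF : F ≠ 0)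
    {S : ℂ → ℂ}
    (hFS : ∀ z : ℂ, 0 < z.im → (F.map (Polynomial.evalRingHom z)).eval (S z) = 0) :
    F.natDegree ≠ 0 := by
  intro h0
  obtain ⟨p, rfl⟩ := Polynomial.natDegree_eq_zero.mp h0
  apply hF
  rw [Polynomial.eq_zero_of_infinite_isRoot p, Polynomial.C_0]
  refine Set.infinite_of_injective_forall_mem (f := fun n : ℕ => ((n : ℂ) + 1) * Complex.I)
    (fun m n hmn => ?_) fun n => ?_
  · simpa using hmn
  · have := hFS (((n : ℂ) + 1) * Complex.I) (by simp; positivity)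
    simpa using this

theorem isOpen_ofReal_notMem_badSet (F : Polynomial (Polynomial ℂ)) :
    IsOpen {y : ℝ | (y : ℂ) ∉ badSet F} := by
  have : Continuous fun y : ℝ => Polynomial.eval (y : ℂ) (F.leadingCoeff * discY F) :=
    (Polynomial.continuous _).comp Complex.continuous_ofReal
  exact isOpen_ne_fun this continuous_const

theorem eq_Ioo_of_isOpen_of_isConnected {I : Set ℝ} (ho : IsOpen I) (hc : IsConnected I)
    (hb : Bornology.IsBounded I) : I = Set.Ioo (sInf I) (sSup I) := by
  refine Set.Subset.antisymm ?_ (hc.Ioo_csInf_csSup_subset hb.bddBelow hb.bddAbove)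
  rw [← interior_Icc]
  exact interior_maximal (subset_Icc_csInf_csSup hb.bddBelow hb.bddAbove) ho

/-- **Theorem 1.3** (regularity from algebraicity).  Let `μ` be a probability
measure on `ℝ` with compact support `K = measSupport μ`, whose Stieltjes
transform satisfies `F(z, S(z)) = 0` (for `z ∉ K`) for a nonzero polynomial
`F(X,Y) = ∑ F_i(X) Yⁱ` whose discriminant in `Y` does not vanish identically;
let `A` be the set of zeros of `F_n(X)·D(X)` and `I` a connected component of
`ℝ ∖ A`.  If `I ∖ K ≠ ∅` then `μ|_I = 0`; if `I` is bounded and `μ|_I ≠ 0`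
then `μ|_I` has a density of rational beta type with respect to Lebesgue
measure. -/
theorem restriction_vanishes_or_rational_beta_density
    (μ : Measure ℝ) [IsProbabilityMeasure μ]
    (hKcpt : IsCompact (measSupport μ))
    (hKfull : μ (measSupport μ)ᶜ = 0)
    (F : Polynomial (Polynomial ℂ)) (hF : F ≠ 0)
    (hD : discY F ≠ 0)
    (hFS : ∀ z : ℂ, (∀ x ∈ measSupport μ, (x : ℂ) ≠ z) →
      Polynomial.eval (stieltjes μ z) (F.map (Polynomial.evalRingHom z)) = 0)
    (I : Set ℝ)
    (hI : ∃ x : ℝ, ((x : ℂ) ∉ badSet F) ∧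
      I = connectedComponentIn {y : ℝ | ((y : ℂ) ∉ badSet F)} x) :
    ((I \ measSupport μ).Nonempty → μ.restrict I = 0) ∧
    (Bornology.IsBounded I → μ.restrict I ≠ 0 →
      ∃ a b : ℝ, a < b ∧ I = Set.Ioo a b ∧
        ∃ h : ℝ → ℝ, RationalBetaType h a b ∧
          μ.restrict I =
            (volume.restrict I).withDensity fun x => ENNReal.ofReal (h x)) := by
  obtain ⟨x₀, hx₀, rfl⟩ := hI
  set I := connectedComponentIn {y : ℝ | (y : ℂ) ∉ badSet F} x₀
  have hIo : IsOpen I := (isOpen_ofReal_notMem_badSet F).connectedComponentIn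
  have hIc : IsConnected I := isConnected_connectedComponentIn_iff.mpr hx₀
  have hIA : ∀ x ∈ I, (x : ℂ) ∉ badSet F := fun x hx => connectedComponentIn_subset _ _ hx
  have hFS' : ∀ z : ℂ, 0 < z.im →
      (F.map (Polynomial.evalRingHom z)).eval (stieltjes μ z) = 0 := by
    refine fun z hz => hFS z fun x _ hxz => ?_
    rw [← hxz, Complex.ofReal_im] at hz
    exact lt_irrefl _ hz
  have hdeg : F.natDegree ≠ 0 := natDegree_ne_zero_of_eval_eq_zero hF hFS'
  set h := stieltjesDensity μ
  have han : AnalyticOnNhd ℝ h I := fun x hx => analyticAt_stieltjesDensity hdeg (hIA x hx) hFS'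
  have hnonneg : ∀ x ∈ I, 0 ≤ h x := fun x hx => stieltjesDensity_nonneg hdeg (hIA x hx) hFS'
  have hμ : μ.restrict I = (volume.restrict I).withDensity fun x => ENNReal.ofReal (h x) :=
    restrict_eq_withDensity_stieltjesDensity hdeg hIo hIA hFS'
  have hzero : Set.EqOn h 0 I → μ.restrict I = 0 := by
    intro h0
    rw [hμ, withDensity_congr_ae (g := 0), withDensity_zero]
    filter_upwards [ae_restrict_mem hIo.measurableSet] with x hx
    simp [h0 hx]
  refine ⟨?_, fun hb hne => ?_⟩
  · rintro ⟨x, hxI, hxK⟩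
    simp only [measSupport, Set.mem_ofPred_eq, not_forall, not_lt, nonpos_iff_eq_zero] at hxK
    obtain ⟨U, hU, hxU, hμU⟩ := hxK
    refine hzero (han.eqOn_zero_of_preconnected_of_eventuallyEq_zero hIc.isPreconnected hxI ?_)
    have hV : IsOpen (U ∩ I) := hU.inter hIo
    have hVzero : (volume.restrict I).withDensity (fun x => ENNReal.ofReal (h x)) (U ∩ I) = 0 := by
      rw [← hμ]
      exact measure_mono_null Set.inter_subset_left
        (le_antisymm ((Measure.restrict_apply_le _ _).trans hμU.le) bot_le)
    have hae : h =ᵐ[volume.restrict (U ∩ I)] 0 := by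
      rw [withDensity_apply _ hV.measurableSet, Measure.restrict_restrict hV.measurableSet,
        Set.inter_assoc, Set.inter_self] at hVzero
      have hmeas : AEMeasurable h (volume.restrict (U ∩ I)) :=
        (han.continuousOn.mono Set.inter_subset_right).aemeasurable hV.measurableSet
      rw [lintegral_eq_zero_iff' hmeas.ennreal_ofReal] at hVzero
      filter_upwards [hVzero, ae_restrict_mem hV.measurableSet] with y hy hyV
      exact le_antisymm (ENNReal.ofReal_eq_zero.mp hy) (hnonneg y hyV.2)
    have heq := Measure.eqOn_open_of_ae_eq hae hV
      (han.continuousOn.mono Set.inter_subset_right) continuousOn_const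
    exact heq.eventuallyEq_of_mem (hV.mem_nhds ⟨hxU, hxI⟩)
  · have hI : I = Set.Ioo (sInf I) (sSup I) := eq_Ioo_of_isOpen_of_isConnected hIo hIc hb
    have hab : sInf I < sSup I := Set.nonempty_Ioo.mp (hI ▸ hIc.nonempty)
    have hInt : IntegrableOn h I := by
      refine ⟨han.continuousOn.aestronglyMeasurable hIo.measurableSet, ?_⟩
      have hfin : ∫⁻ x in I, ENNReal.ofReal (h x) < ⊤ := by
        have := congrArg (fun ν : Measure ℝ => ν Set.univ) hμ
        simp only [withDensity_apply _ MeasurableSet.univ, Measure.restrict_univ] at this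
        rw [← this]
        exact measure_lt_top _ _
      rwa [hasFiniteIntegral_iff_ofReal]
      exact ae_restrict_of_forall_mem hIo.measurableSet hnonneg
    obtain ⟨P, hP, hPh⟩ := exists_polynomial_im_of_algebraic hF fun x hx =>
      eval_stieltjesBoundary_eq_zero (hIA x hx) hFS'
    obtain ⟨Q, hQ, hQh⟩ := exists_polynomial_coeff_zero_ne_zero hIo hIc.isPreconnected han
      (fun h0 => hne (hzero h0)) hP hPh
    refine ⟨sInf I, sSup I, hab, hI, h, ?_, hμ⟩
    refine rationalBetaType_of_algebraic hab (P := Q) ?_ ?_ ?_ hQ ?_ <;> rwa [← hI]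

end
end

section
/- Let φ₁,…,φ_N be an n-variable DIRE family. Then each φ_i is an n-variable algebraic function. -/
open MeasureTheory Filter
open scoped Classical

noncomputable section

/-! ### DIRE families -/

/-- A family `φ₁,…,φ_N` of holomorphic functions, `φ i` defined on the connected
open neighborhood `U i` of the origin of `ℂⁿ`, is *defined implicitly by rational
equations* (DIRE) if there are rational functions `Φ_i = A_i/B_i` over
`ℂ(X₁,…,X_{n+N})` defined at the origin (`B_i(0) ≠ 0`) with `Φ_i(0) = 0`
(equivalently `A_i(0) = 0`), invertible Jacobian
`det (∂Φ_i/∂X_{n+j})(0) = det (A_i)'_{X_{n+j}}(0)/B_i(0) ≠ 0`, and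
`Φ_i(z, φ₁(z) − φ₁(0), …, φ_N(z) − φ_N(0)) = 0` for all `z` near `0`. -/
structure IsDIREFamily {n N : ℕ} (U : Fin N → Set (Fin n → ℂ))
    (φ : Fin N → (Fin n → ℂ) → ℂ) : Prop where
  isOpen : ∀ i, IsOpen (U i)
  isConnected : ∀ i, IsConnected (U i)
  mem_zero : ∀ i, (0 : Fin n → ℂ) ∈ U i
  holo : ∀ i, DifferentiableOn ℂ (φ i) (U i)
  rational : ∃ A B : Fin N → MvPolynomial (Fin (n + N)) ℂ,
    (∀ i, MvPolynomial.eval (0 : Fin (n + N) → ℂ) (B i) ≠ 0) ∧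
    (∀ i, MvPolynomial.eval (0 : Fin (n + N) → ℂ) (A i) = 0) ∧
    Matrix.det (Matrix.of fun i j : Fin N =>
        MvPolynomial.eval (0 : Fin (n + N) → ℂ)
            (MvPolynomial.pderiv (Fin.natAdd n j) (A i)) /
          MvPolynomial.eval (0 : Fin (n + N) → ℂ) (B i)) ≠ 0 ∧
    ∀ᶠ z : Fin n → ℂ in nhds 0, ∀ i,
      MvPolynomial.eval (Fin.append z fun j => φ j z - φ j 0) (A i) = 0

/-! ### The identity theorem, via restriction to complex lines -/

section Holomorphic

open Topology

variable {E : Type*} [NormedAddCommGroup E] [NormedSpace ℂ E]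

theorem DifferentiableOn.eqOn_zero_of_convex_of_eventuallyEq_zero {f : E → ℂ} {V : Set E}
    (hf : DifferentiableOn ℂ f V) (hV : IsOpen V) (hc : Convex ℝ V) {z₀ : E} (h₀ : z₀ ∈ V)
    (hz : f =ᶠ[𝓝 z₀] 0) : Set.EqOn f 0 V := by
  intro w hw
  let l : ℂ → E := fun t => z₀ + t • (w - z₀)
  have hl : Differentiable ℂ l := by fun_prop
  have hl0 : l 0 = z₀ := by simp [l]
  have hl1 : l 1 = w := by simp [l]
  have hopen : IsOpen (l ⁻¹' V) := hV.preimage hl.continuous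
  have hconv : Convex ℝ (l ⁻¹' V) :=
    (hc.translate_preimage_right z₀).linear_preimage
      ((LinearMap.toSpanSingleton ℂ E (w - z₀)).restrictScalars ℝ)
  have hd : DifferentiableOn ℂ (f ∘ l) (l ⁻¹' V) :=
    hf.comp hl.differentiableOn fun t ht => ht
  have hev : f ∘ l =ᶠ[𝓝 0] 0 := by
    have ht : Tendsto l (𝓝 0) (𝓝 z₀) := hl0 ▸ hl.continuous.tendsto 0
    exact ht.eventually hz
  have := (hd.analyticOnNhd hopen).eqOn_zero_of_preconnected_of_eventuallyEq_zero
    hconv.isPreconnected (z₀ := 0) (by simpa [hl0] using h₀) hev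
    (x := 1) (by simpa [hl1] using hw)
  simpa [hl1] using this

theorem DifferentiableOn.eqOn_zero_of_isPreconnected_of_eventuallyEq_zero {f : E → ℂ} {U : Set E}
    (hf : DifferentiableOn ℂ f U) (hU : IsOpen U) (hc : IsPreconnected U) {z₀ : E} (h₀ : z₀ ∈ U)
    (hz : f =ᶠ[𝓝 z₀] 0) : Set.EqOn f 0 U := by
  have hsub : U ⊆ {z | f =ᶠ[𝓝 z] 0} := by
    refine hc.subset_of_closure_inter_subset isOpen_setOfPred_eventually_nhds ⟨z₀, h₀, hz⟩ ?_
    rintro z ⟨hz, hzU⟩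
    obtain ⟨r, hr, hrU⟩ := Metric.isOpen_iff.1 hU z hzU
    obtain ⟨w, hw, hwr⟩ := mem_closure_iff_nhds.1 hz _ (Metric.ball_mem_nhds z hr)
    have hball := (hf.mono hrU).eqOn_zero_of_convex_of_eventuallyEq_zero Metric.isOpen_ball
      (convex_ball z r) hw hwr
    exact Filter.eventually_of_mem (Metric.ball_mem_nhds z hr) hball
  exact fun z hzU => (hsub hzU).self_of_nhds

theorem differentiableOn_eval_mvPolynomial {σ : Type*} {f : E → σ → ℂ} {U : Set E}
    (hf : ∀ j, DifferentiableOn ℂ (fun z => f z j) U) (F : MvPolynomial σ ℂ) :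
    DifferentiableOn ℂ (fun z => MvPolynomial.eval (f z) F) U := by
  induction F using MvPolynomial.induction_on with
  | C a => simp
  | add p q hp hq => simpa using hp.fun_add hq
  | mul_X p j hp => simpa using hp.fun_mul (hf j)

/-- The algebra of holomorphic functions on `V`, as functions on the subtype `V`. -/
def holomorphicSubalgebra (V : Set E) : Subalgebra ℂ (V → ℂ) where
  carrier := {g | ∃ f : E → ℂ, DifferentiableOn ℂ f V ∧ ∀ x : V, g x = f x}
  mul_mem' := by
    rintro _ _ ⟨f, hf, h⟩ ⟨f', hf', h'⟩
    exact ⟨fun z => f z * f' z, hf.mul hf', fun x => by simp [h, h']⟩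
  add_mem' := by
    rintro _ _ ⟨f, hf, h⟩ ⟨f', hf', h'⟩
    exact ⟨fun z => f z + f' z, hf.add hf', fun x => by simp [h, h']⟩
  algebraMap_mem' c := ⟨fun _ => c, differentiableOn_const c, fun _ => rfl⟩

theorem isDomain_holomorphicSubalgebra {V : Set E} (hV : IsOpen V) (hc : Convex ℝ V)
    (hne : V.Nonempty) : IsDomain (holomorphicSubalgebra V) := by
  have : Nonempty V := hne.to_subtype
  have : NoZeroDivisors (holomorphicSubalgebra V) := by
    refine ⟨?_⟩
    rintro ⟨a, f, hf, haf⟩ ⟨b, g, hg, hbg⟩ hab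
    by_contra! hcon
    have hfg : ∀ z ∈ V, f z * g z = 0 := fun z hz => by
      simpa [haf, hbg] using congrFun (congrArg Subtype.val hab) ⟨z, hz⟩
    obtain ⟨z, hz, hfz⟩ : ∃ z ∈ V, f z ≠ 0 := by
      by_contra! h0
      exact hcon.1 (Subtype.ext (funext fun x => by simpa [haf] using h0 x x.2))
    have hgz : g =ᶠ[𝓝 z] 0 := by
      have hcont : ContinuousAt f z := hf.continuousOn.continuousAt (hV.mem_nhds hz)
      filter_upwards [hcont.eventually_ne hfz, hV.mem_nhds hz] with w hw hwV
      exact (mul_eq_zero.1 (hfg w hwV)).resolve_left hw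
    have hg0 := hg.eqOn_zero_of_convex_of_eventuallyEq_zero hV hc hz hgz
    exact hcon.2 (Subtype.ext (funext fun x => by simpa [hbg] using hg0 x.2))
  exact NoZeroDivisors.to_isDomain _

end Holomorphic

/-! ### Jacobian criterion for algebraicity -/

section Algebra

theorem Derivation.map_mvPolynomial_aeval {k R M σ : Type*} [CommRing k] [CommRing R]
    [Algebra k R] [AddCommGroup M] [Module k M] [Module R M] [Fintype σ]
    (D : Derivation k R M) (v : σ → R) (P : MvPolynomial σ k) :
    D (MvPolynomial.aeval v P) =
      ∑ i, MvPolynomial.aeval v (MvPolynomial.pderiv i P) • D (v i) := by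
  induction P using MvPolynomial.induction_on with
  | C a => simp
  | add p q hp hq => simp [hp, hq, add_smul, Finset.sum_add_distrib]
  | mul_X p j hp =>
    simp only [map_mul, MvPolynomial.aeval_X, Derivation.leibniz, hp, MvPolynomial.pderiv_X,
      smul_eq_mul, map_add, add_smul, Finset.sum_add_distrib, Finset.smul_sum, mul_smul]
    congr 1
    rw [Finset.sum_eq_single j]
    · simp
    · intro i _ hij
      simp [Pi.single_eq_of_ne hij.symm]
    · simp

theorem eq_zero_of_sum_smul_eq_zero_of_det_ne_zero {K M ι : Type*} [Field K] [AddCommGroup M]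
    [Module K M] [Fintype ι] [DecidableEq ι] {J : Matrix ι ι K} (hJ : J.det ≠ 0) {w : ι → M}
    (hw : ∀ i, ∑ j, J i j • w j = 0) (j : ι) : w j = 0 := by
  rw [← Module.forall_dual_apply_eq_zero_iff K]
  intro f
  refine congrFun (Matrix.eq_zero_of_mulVec_eq_zero hJ (v := fun j => f (w j)) ?_) j
  ext i
  simpa [Matrix.mulVec, dotProduct] using congrArg f (hw i)

theorem isAlgebraic_of_kaehlerDifferential_D_eq_zero {K L : Type*} [Field K] [CharZero K] [Field L]
    [Algebra K L] {s : Set L} (hs : s.Finite)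
    (hD : ∀ y : IntermediateField.adjoin K s, (y : L) ∈ s →
      KaehlerDifferential.D K (IntermediateField.adjoin K s) y = 0) :
    ∀ y ∈ s, IsAlgebraic K y := by
  set E := IntermediateField.adjoin K s
  have hD0 : ∀ y : E, KaehlerDifferential.D K E y = 0 := by
    rintro ⟨y, hy⟩
    induction hy using IntermediateField.adjoin_induction with
    | mem x hx => exact hD _ hx
    | algebraMap x => exact (KaehlerDifferential.D K E).map_algebraMap x
    | add x y hx hy ihx ihy =>
      rw [show (⟨x + y, add_mem hx hy⟩ : E) = ⟨x, hx⟩ + ⟨y, hy⟩ from rfl, map_add, ihx, ihy, add_zero]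
    | inv x hx ih =>
      have : (⟨x⁻¹, inv_mem hx⟩ : E) = (⟨x, hx⟩ : E)⁻¹ := rfl
      rw [this, Derivation.leibniz_inv, ih, smul_zero]
    | mul x y hx hy ihx ihy =>
      rw [show (⟨x * y, mul_mem hx hy⟩ : E) = ⟨x, hx⟩ * ⟨y, hy⟩ from rfl, Derivation.leibniz, ihx, ihy, smul_zero, smul_zero, add_zero]
  have hur : Algebra.FormallyUnramified K E := by
    refine ⟨?_⟩
    rw [← Submodule.subsingleton_iff E, ← subsingleton_iff_bot_eq_top, eq_comm, eq_bot_iff,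
      ← KaehlerDifferential.span_range_derivation, Submodule.span_le]
    rintro _ ⟨y, rfl⟩
    simpa using hD0 y
  have : Algebra.EssFiniteType K E :=
    IntermediateField.essFiniteType_iff.2 (IntermediateField.fg_adjoin_of_finite hs)
  have : Algebra.IsSeparable K E := (Algebra.FormallyUnramified.iff_isSeparable K E).1 hur
  intro y hy
  have := Algebra.IsAlgebraic.isAlgebraic (R := K)
    (⟨y, IntermediateField.subset_adjoin K s hy⟩ : E)
  exact this.algebraMap (A := L)

theorem isAlgebraic_adjoin_of_det_pderiv_ne_zero {k L : Type*} [Field k] [CharZero k] [Field L]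
    [Algebra k L] {n N : ℕ} (x : Fin n → L) (y : Fin N → L)
    (A : Fin N → MvPolynomial (Fin (n + N)) k)
    (hA : ∀ i, MvPolynomial.aeval (Fin.append x y) (A i) = 0)
    (hJ : (Matrix.of fun i j : Fin N => MvPolynomial.aeval (Fin.append x y)
      (MvPolynomial.pderiv (Fin.natAdd n j) (A i))).det ≠ 0) (i : Fin N) :
    IsAlgebraic (Algebra.adjoin k (Set.range x)) (y i) := by
  let K := IntermediateField.adjoin k (Set.range x)
  suffices h : IsAlgebraic K (y i) by
    open scoped IntermediateField.algebraAdjoinAdjoin in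
    exact (IsFractionRing.isAlgebraic_iff (Algebra.adjoin k (Set.range x)) K L).2 h
  refine isAlgebraic_of_kaehlerDifferential_D_eq_zero (Set.finite_range y) ?_ (y i) ⟨i, rfl⟩
  let E := IntermediateField.adjoin K (Set.range y)
  let D := (KaehlerDifferential.D K E).restrictScalars k
  let x' : Fin n → E := fun j => algebraMap K E
    ⟨x j, IntermediateField.subset_adjoin k _ ⟨j, rfl⟩⟩
  let y' : Fin N → E := fun j => ⟨y j, IntermediateField.subset_adjoin K _ ⟨j, rfl⟩⟩
  have hval : ∀ P : MvPolynomial (Fin (n + N)) k,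
      (MvPolynomial.aeval (Fin.append x' y') P : L) = MvPolynomial.aeval (Fin.append x y) P := by
    intro P
    have : IsScalarTower k E L := IsScalarTower.of_algebraMap_eq fun _ => rfl
    have := MvPolynomial.aeval_algebraMap_apply (R := k) (A := E) L (Fin.append x' y') P
    rw [show ((MvPolynomial.aeval (Fin.append x' y') P : E) : L) = algebraMap E L _ from rfl,
      ← this]
    congr 2
    ext j
    refine Fin.addCases (fun j => ?_) (fun j => ?_) j
    · simp [x']
    · simp [y']
  have hx' : ∀ j, D (x' j) = 0 := fun j => (KaehlerDifferential.D K E).map_algebraMap _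
  have hy' : ∀ j, D (y' j) = 0 := by
    refine eq_zero_of_sum_smul_eq_zero_of_det_ne_zero (K := E)
      (J := Matrix.of fun i j => MvPolynomial.aeval (Fin.append x' y')
        (MvPolynomial.pderiv (Fin.natAdd n j) (A i))) ?_ fun i => ?_
    · intro h0
      apply hJ
      have := congrArg (algebraMap E L) h0
      rw [RingHom.map_det, map_zero] at this
      rw [← this]
      congr 1
      ext a b
      exact (hval _).symm
    · have h0 : MvPolynomial.aeval (Fin.append x' y') (A i) = 0 :=
        Subtype.ext ((hval _).trans (hA i))
      have := D.map_mvPolynomial_aeval (Fin.append x' y') (A i)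
      rw [h0, map_zero, Fin.sum_univ_add] at this
      simpa [hx'] using this.symm
  rintro ⟨_, _⟩ ⟨j, rfl⟩
  exact hy' j

theorem exists_mvPolynomial_aeval_snoc_eq_zero {k L : Type*} [Field k] [Field L] [Algebra k L]
    {n : ℕ} (x : Fin n → L) {a : L} (ha : IsAlgebraic (Algebra.adjoin k (Set.range x)) a) :
    ∃ F : MvPolynomial (Fin (n + 1)) k, F ≠ 0 ∧
      MvPolynomial.aeval (Fin.snoc x a : Fin (n + 1) → L) F = 0 := by
  have hdep : ¬ AlgebraicIndependent k (Fin.snoc x a : Fin (n + 1) → L) := by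
    intro h
    have h' : AlgebraicIndependent k (fun o : Option (Fin n) => o.elim a x) := by
      convert h.comp _ finSuccEquivLast.symm.injective using 1
      ext o
      cases o <;> simp
    exact (AlgebraicIndependent.option_iff.1 h').2 ha
  rw [algebraicIndependent_iff] at hdep
  push Not at hdep
  obtain ⟨F, hF, hF0⟩ := hdep
  exact ⟨F, hF0, hF⟩

end Algebra

/-- **Theorem 6.1**: every member of an `n`-variable DIRE family is an
`n`-variable algebraic function. -/
theorem dire_family_algebraic {n N : ℕ} (hn : 0 < n) (hN : 0 < N)
    (U : Fin N → Set (Fin n → ℂ)) (φ : Fin N → (Fin n → ℂ) → ℂ)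
    (h : IsDIREFamily U φ) :
    ∀ i, ∃ F : MvPolynomial (Fin (n + 1)) ℂ, F ≠ 0 ∧
      ∀ z ∈ U i, MvPolynomial.eval (Fin.snoc z (φ i z)) F = 0 := by
  intro i
  obtain ⟨A, B, -, -, hJ, hA⟩ := h.rational
  have hU : ∀ᶠ z in nhds (0 : Fin n → ℂ), ∀ i, z ∈ U i :=
    eventually_all.2 fun i => (h.isOpen i).mem_nhds (h.mem_zero i)
  obtain ⟨r, hr, hV⟩ := Metric.eventually_nhds_iff_ball.1 (hU.and hA)
  set V := Metric.ball (0 : Fin n → ℂ) r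
  have h0V : (0 : Fin n → ℂ) ∈ V := Metric.mem_ball_self hr
  let S := holomorphicSubalgebra V
  have : IsDomain S := isDomain_holomorphicSubalgebra Metric.isOpen_ball (convex_ball 0 r) ⟨0, h0V⟩
  let L := FractionRing S
  let ev : V → S →ₐ[ℂ] ℂ := fun z => (Pi.evalAlgHom ℂ (fun _ : V => ℂ) z).comp S.val
  let x : Fin n → S := fun k =>
    ⟨fun z => z.1 k, fun z => z k, by fun_prop, fun _ => rfl⟩
  let g : Fin N → S := fun j =>
    ⟨fun z => φ j z, φ j, (h.holo j).mono fun z hz => (hV z hz).1 j, fun _ => rfl⟩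
  let y : Fin N → S := fun j => g j - algebraMap ℂ S (φ j 0)
  have hev : ∀ (z : V) (P : MvPolynomial (Fin (n + N)) ℂ),
      ev z (MvPolynomial.aeval (Fin.append x y) P) =
        MvPolynomial.eval (Fin.append z.1 fun j => φ j z - φ j 0) P := by
    intro z P
    have := (MvPolynomial.comp_aeval_apply (Fin.append x y) (ev z) P)
    rw [this, MvPolynomial.aeval_eq_eval]
    congr 2
    ext j
    refine Fin.addCases (fun j => ?_) (fun j => ?_) j
    · simp [ev, x]
    · simp [ev, y, g]
  have hzero : ∀ P : S, (∀ z : V, ev z P = 0) → P = 0 := fun P hP =>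
    Subtype.ext (funext hP)
  have hval : ∀ P : MvPolynomial (Fin (n + N)) ℂ,
      MvPolynomial.aeval (Fin.append (algebraMap S L ∘ x) (algebraMap S L ∘ y)) P =
        algebraMap S L (MvPolynomial.aeval (Fin.append x y) P) := by
    intro P
    rw [← MvPolynomial.aeval_algebraMap_apply]
    congr 2
    ext j
    refine Fin.addCases (fun j => ?_) (fun j => ?_) j <;> simp
  have halg := isAlgebraic_adjoin_of_det_pderiv_ne_zero (k := ℂ)
    (algebraMap S L ∘ x) (algebraMap S L ∘ y) A ?_ ?_ i
  · have halg' : IsAlgebraic (Algebra.adjoin ℂ (Set.range (algebraMap S L ∘ x)))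
        (algebraMap S L (g i)) := by
      have hc := isAlgebraic_algebraMap (R := Algebra.adjoin ℂ (Set.range (algebraMap S L ∘ x)))
        (A := L) (algebraMap ℂ _ (φ i 0))
      have hsum : algebraMap S L (g i) = (algebraMap S L ∘ y) i + algebraMap
          (Algebra.adjoin ℂ (Set.range (algebraMap S L ∘ x))) L (algebraMap ℂ _ (φ i 0)) := by
        rw [← IsScalarTower.algebraMap_apply, IsScalarTower.algebraMap_apply ℂ S L]
        simp [y]
      exact hsum ▸ halg.add hc
    obtain ⟨F, hF0, hF⟩ := exists_mvPolynomial_aeval_snoc_eq_zero _ halg'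
    refine ⟨F, hF0, ?_⟩
    have hFS : MvPolynomial.aeval (Fin.snoc x (g i) : Fin (n + 1) → S) F = 0 := by
      apply IsFractionRing.injective S L
      rw [map_zero, ← MvPolynomial.aeval_algebraMap_apply, ← hF]
      congr 2
      ext j
      refine Fin.lastCases ?_ (fun j => ?_) j <;> simp
    have hFV : ∀ z ∈ V, MvPolynomial.eval (Fin.snoc z (φ i z)) F = 0 := by
      intro z hz
      have := congrArg (ev ⟨z, hz⟩) hFS
      rw [map_zero, MvPolynomial.comp_aeval_apply, MvPolynomial.aeval_eq_eval] at this
      rw [← this]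
      congr 2
      ext j
      refine Fin.lastCases ?_ (fun j => ?_) j <;> simp [ev, x, g]
    have hd : DifferentiableOn ℂ (fun z => MvPolynomial.eval (Fin.snoc z (φ i z)) F) (U i) := by
      refine differentiableOn_eval_mvPolynomial (fun j => ?_) F
      refine Fin.lastCases ?_ (fun j => ?_) j
      · simpa using h.holo i
      · simp only [Fin.snoc_castSucc]
        fun_prop
    exact hd.eqOn_zero_of_isPreconnected_of_eventuallyEq_zero (h.isOpen i)
      (h.isConnected i).isPreconnected (h.mem_zero i)
      (Filter.eventually_of_mem (Metric.ball_mem_nhds 0 hr) hFV)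
  · intro j
    have : MvPolynomial.aeval (Fin.append x y) (A j) = 0 :=
      hzero _ fun z => (hev z _).trans ((hV z z.2).2 j)
    rw [hval, this, map_zero]
  · intro hdet
    have hS : (Matrix.of fun a b : Fin N => MvPolynomial.aeval (Fin.append x y)
        (MvPolynomial.pderiv (Fin.natAdd n b) (A a))).det = 0 := by
      apply IsFractionRing.injective S L
      rw [map_zero, RingHom.map_det, ← hdet]
      congr 1
      ext a b
      exact (hval _).symm
    have h0 := congrArg (ev ⟨0, h0V⟩) hS
    rw [map_zero, AlgHom.map_det] at h0
    have happ : Fin.append (0 : Fin n → ℂ) (fun j => φ j 0 - φ j 0) = 0 := by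
      ext j
      refine Fin.addCases (fun j => ?_) (fun j => ?_) j <;> simp
    apply hJ
    rw [← mul_zero (∏ a, (MvPolynomial.eval (0 : Fin (n + N) → ℂ) (B a))⁻¹), ← h0,
      ← Matrix.det_mul_column]
    congr 1
    ext a b
    have := hev ⟨0, h0V⟩ (MvPolynomial.pderiv (Fin.natAdd n b) (A a))
    rw [happ] at this
    simp [this, div_eq_inv_mul]
end
end

section
/- Let n and N be positive integers and let F₁,…,F_N ∈ ℂ[X₁,…,X_{n+N}] be polynomials such that F_i(0) = 0 for i = 1,…,N and det_{i,j=1}^N (∂F_i/∂X_{j+n})(0) ≠ 0. Let I ⊂ ℂ[X₁,…,X_{n+N}] be the ideal generated by F₁,…,F_N. Then there exist polynomials G ∈ ℂ[X₁,…,X_{n+1}] and H ∈ ℂ[X₁,…,X_{n+N}] such that G ≠ 0, H(0) ≠ 0, and G·H ∈ I. -/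
open scoped Classical

noncomputable section

/-- An essentially finite type, formally unramified algebra over a domain, in which every nonzero
element of the domain is invertible, is algebraic over this domain. -/
theorem isAlgebraic_of_formallyUnramified_of_isUnit {S E : Type*} [CommRing S] [IsDomain S]
    [CommRing E] [Algebra S E] [Algebra.FormallyUnramified S E] [Algebra.EssFiniteType S E]
    (hu : ∀ s : S, s ≠ 0 → IsUnit (algebraMap S E s)) (x : E) : IsAlgebraic S x := by
  have hunit : ∀ y : nonZeroDivisors S, IsUnit (algebraMap S E y) :=
    fun y => hu y (nonZeroDivisors.coe_ne_zero y)
  let : Algebra (FractionRing S) E := (IsLocalization.lift hunit).toAlgebra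
  have : IsScalarTower S (FractionRing S) E :=
    IsScalarTower.of_algebraMap_eq fun s => (IsLocalization.lift_eq hunit s).symm
  have : Algebra.FormallyUnramified (FractionRing S) E :=
    Algebra.FormallyUnramified.of_restrictScalars S _ _
  have : Algebra.EssFiniteType (FractionRing S) E := Algebra.EssFiniteType.of_comp S _ _
  have : Module.Finite (FractionRing S) E := Algebra.FormallyUnramified.finite_of_free _ _
  exact (IsFractionRing.isAlgebraic_iff S (FractionRing S) E).2
    (Algebra.IsIntegral.isIntegral x).isAlgebraic

/-- The chain rule for a derivation on a polynomial ring. -/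
theorem MvPolynomial.derivation_eq_sum_pderiv {k σ M : Type*} [CommRing k] [Fintype σ]
    [AddCommGroup M] [Module k M] [Module (MvPolynomial σ k) M]
    [IsScalarTower k (MvPolynomial σ k) M]
    (D : Derivation k (MvPolynomial σ k) M) (f : MvPolynomial σ k) :
    D f = ∑ i, MvPolynomial.pderiv i f • D (MvPolynomial.X i) := by
  have h : D = ∑ i, (LinearMap.toSpanSingleton (MvPolynomial σ k) M
      (D (MvPolynomial.X i))).compDer (MvPolynomial.pderiv i) := by
    refine MvPolynomial.derivation_ext fun j => ?_
    rw [← Derivation.coeFnAddMonoidHom_apply (∑ i, _), map_sum, Finset.sum_apply]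
    rw [Finset.sum_eq_single j]
    · simp
    · intro b _ hb
      simp [MvPolynomial.pderiv_X_of_ne hb.symm]
    · simp
  conv_lhs => rw [h]
  rw [← Derivation.coeFnAddMonoidHom_apply (∑ i, _), map_sum, Finset.sum_apply]
  simp

/-- A vector with entries in a module that is killed by a square matrix is killed by its
determinant. -/
theorem Matrix.det_smul_eq_zero_of_sum_smul_eq_zero {R M ι : Type*} [CommRing R] [AddCommGroup M]
    [Module R M] [Fintype ι] [DecidableEq ι] (A : Matrix ι ι R) (v : ι → M)
    (h : ∀ i, ∑ j, A i j • v j = 0) (l : ι) : A.det • v l = 0 := by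
  have h1 : ∑ i, A.adjugate l i • ∑ j, A i j • v j = 0 := by simp [h]
  simp_rw [Finset.smul_sum, smul_smul] at h1
  rw [Finset.sum_comm] at h1
  simp_rw [← Finset.sum_smul, ← Matrix.mul_apply, Matrix.adjugate_mul] at h1
  simpa [Matrix.one_apply, ite_smul] using h1

/-- The Jacobian criterion for formal unramifiedness, relative to the first `n` variables, for a
localization of a quotient of a polynomial ring. -/
theorem formallyUnramified_of_isUnit_det_pderiv {k S E : Type*} {n N : ℕ} [CommRing k] [CommRing S]
    [CommRing E] [Algebra k S] [Algebra S (MvPolynomial (Fin (n + N)) k)]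
    [IsScalarTower k S (MvPolynomial (Fin (n + N)) k)]
    [Algebra (MvPolynomial (Fin (n + N)) k) E] [Algebra S E] [Algebra k E]
    [IsScalarTower k S E] [IsScalarTower k (MvPolynomial (Fin (n + N)) k) E]
    [IsScalarTower S (MvPolynomial (Fin (n + N)) k) E]
    (F : Fin N → MvPolynomial (Fin (n + N)) k)
    (hX : ∀ i, ∃ s : S, algebraMap S (MvPolynomial (Fin (n + N)) k) s =
      MvPolynomial.X (Fin.castAdd N i))
    (hF : ∀ i, algebraMap (MvPolynomial (Fin (n + N)) k) E (F i) = 0)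
    (hJ : IsUnit (algebraMap (MvPolynomial (Fin (n + N)) k) E
      (Matrix.of fun i j => MvPolynomial.pderiv (Fin.natAdd n j) (F i)).det))
    (hfrac : ∀ e : E, ∃ a m : MvPolynomial (Fin (n + N)) k,
      IsUnit (algebraMap (MvPolynomial (Fin (n + N)) k) E m) ∧
        algebraMap _ E m * e = algebraMap _ E a) :
    Algebra.FormallyUnramified S E := by
  let A := MvPolynomial (Fin (n + N)) k
  let d := KaehlerDifferential.D S E
  let D : Derivation k A Ω[E⁄S] := (d.compAlgebraMap A).restrictScalars k
  have hD : ∀ a : A, D a = d (algebraMap A E a) := fun a => rfl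
  have hcast : ∀ i, D (MvPolynomial.X (Fin.castAdd N i)) = 0 := by
    intro i
    obtain ⟨s, hs⟩ := hX i
    rw [hD, ← hs, ← IsScalarTower.algebraMap_apply, Derivation.map_algebraMap]
  have hnat : ∀ j, D (MvPolynomial.X (Fin.natAdd n j)) = 0 := by
    intro j
    have h := Matrix.det_smul_eq_zero_of_sum_smul_eq_zero
      (Matrix.of fun i j => MvPolynomial.pderiv (Fin.natAdd n j) (F i))
      (fun j => D (MvPolynomial.X (Fin.natAdd n j))) (fun i => by
        have h := MvPolynomial.derivation_eq_sum_pderiv D (F i)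
        rw [hD, hF, map_zero, Fin.sum_univ_add] at h
        simpa [hcast] using h.symm) j
    rw [← algebraMap_smul E] at h
    exact hJ.smul_eq_zero.1 h
  have hDz : ∀ a : A, D a = 0 := by
    intro a
    rw [MvPolynomial.derivation_eq_sum_pderiv D a, Fin.sum_univ_add]
    simp [hcast, hnat]
  have hd : ∀ e : E, d e = 0 := by
    intro e
    obtain ⟨a, m, hm, h⟩ := hfrac e
    have h1 := congrArg d h
    rw [Derivation.leibniz, ← hD, ← hD, hDz, hDz, smul_zero, add_zero] at h1
    exact hm.smul_eq_zero.1 h1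
  refine ⟨subsingleton_of_forall_eq 0 fun w => ?_⟩
  have hw : w ∈ Submodule.span E (Set.range (KaehlerDifferential.D S E)) := by
    rw [KaehlerDifferential.span_range_derivation]; trivial
  have hr : Set.range (KaehlerDifferential.D S E) ⊆ {0} := by
    rintro _ ⟨e, rfl⟩
    exact hd e
  simpa using Submodule.span_mono hr hw

/-- An algebraic relation of a ring element over the polynomial ring in `n` variables gives a
polynomial relation in `n + 1` variables. -/
theorem exists_mvPolynomial_ne_zero_of_isAlgebraic {k B : Type*} [CommRing k] [CommRing B]
    [Algebra k B] {n : ℕ} [Algebra (MvPolynomial (Fin n) k) B]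
    [IsScalarTower k (MvPolynomial (Fin n) k) B] (v : Fin (n + 1) → B)
    (hv : ∀ i : Fin n, algebraMap (MvPolynomial (Fin n) k) B (MvPolynomial.X i) = v i.castSucc)
    (h : IsAlgebraic (MvPolynomial (Fin n) k) (v (Fin.last n))) :
    ∃ G : MvPolynomial (Fin (n + 1)) k, G ≠ 0 ∧ MvPolynomial.aeval v G = 0 := by
  obtain ⟨q, hq, hq0⟩ := h
  let e : Polynomial (MvPolynomial (Fin n) k) ≃ₐ[k] MvPolynomial (Fin (n + 1)) k :=
    (MvPolynomial.optionEquivLeft k (Fin n)).symm.trans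
      (MvPolynomial.renameEquiv k (finSuccEquivLast (n := n)).symm)
  refine ⟨e q, by simpa using hq, ?_⟩
  have key : ((MvPolynomial.aeval v).comp e.toAlgHom :
      Polynomial (MvPolynomial (Fin n) k) →ₐ[k] B) =
      (Polynomial.aeval (R := MvPolynomial (Fin n) k) (v (Fin.last n))).restrictScalars k := by
    ext i
    · simp [e, hv]
    · simp [e]
  rw [← hq0]
  exact DFunLike.congr_fun key q

/-- **Theorem 6.5** (algebraicity criterion, algebraic form).  Let
`F₁,…,F_N ∈ ℂ[X₁,…,X_{n+N}]` vanish at the origin and have invertible Jacobian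
`(∂F_i/∂X_{n+j})(0)`.  Then the ideal they generate contains a product `G·H`
with `G` a nonzero polynomial in the variables `X₁,…,X_{n+1}` only and `H` a
polynomial not vanishing at the origin. -/
theorem ideal_contains_product_with_algebraic_factor
    (n N : ℕ) (hn : 0 < n) (hN : 0 < N)
    (F : Fin N → MvPolynomial (Fin (n + N)) ℂ)
    (hF0 : ∀ i, MvPolynomial.eval (0 : Fin (n + N) → ℂ) (F i) = 0)
    (hjac : Matrix.det (Matrix.of fun i j : Fin N =>
        MvPolynomial.eval (0 : Fin (n + N) → ℂ)
          (MvPolynomial.pderiv (Fin.natAdd n j) (F i))) ≠ 0) :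
    ∃ (G : MvPolynomial (Fin (n + 1)) ℂ) (H : MvPolynomial (Fin (n + N)) ℂ),
      G ≠ 0 ∧ MvPolynomial.eval (0 : Fin (n + N) → ℂ) H ≠ 0 ∧
      (MvPolynomial.rename (Fin.castLE (by omega)) G) * H ∈
        Ideal.span (Set.range F) := by
  have hle : n + 1 ≤ n + N := by omega
  set I := Ideal.span (Set.range F)
  set J : MvPolynomial (Fin (n + N)) ℂ :=
    (Matrix.of fun i j => MvPolynomial.pderiv (Fin.natAdd n j) (F i)).det with hJdef
  have hJ0 : MvPolynomial.eval (0 : Fin (n + N) → ℂ) J ≠ 0 := by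
    rw [hJdef, RingHom.map_det]
    exact hjac
  let : Algebra (MvPolynomial (Fin n) ℂ) (MvPolynomial (Fin (n + N)) ℂ) :=
    (MvPolynomial.rename (Fin.castAdd N)).toRingHom.toAlgebra
  have hmap : ∀ s : MvPolynomial (Fin n) ℂ,
      algebraMap _ (MvPolynomial (Fin (n + N)) ℂ) s = MvPolynomial.rename (Fin.castAdd N) s :=
    fun s => rfl
  have : IsScalarTower ℂ (MvPolynomial (Fin n) ℂ) (MvPolynomial (Fin (n + N)) ℂ) :=
    IsScalarTower.of_algebraMap_eq fun c => by
      simp [hmap, MvPolynomial.algebraMap_eq]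
  have : Algebra.FiniteType (MvPolynomial (Fin n) ℂ) (MvPolynomial (Fin (n + N)) ℂ) :=
    Algebra.FiniteType.of_restrictScalars_finiteType ℂ _ _
  let B := MvPolynomial (Fin (n + N)) ℂ ⧸ I
  let U : Submonoid (MvPolynomial (Fin (n + N)) ℂ) := Submonoid.powers J ⊔
    (nonZeroDivisors (MvPolynomial (Fin n) ℂ)).map
      (algebraMap (MvPolynomial (Fin n) ℂ) (MvPolynomial (Fin (n + N)) ℂ))
  let V : Submonoid B := U.map (Ideal.Quotient.mk I)
  let E := Localization V
  have : IsScalarTower (MvPolynomial (Fin n) ℂ) (MvPolynomial (Fin (n + N)) ℂ) E := inferInstance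
  have hunit : ∀ u ∈ U, IsUnit (algebraMap (MvPolynomial (Fin (n + N)) ℂ) E u) := by
    intro u hu
    rw [IsScalarTower.algebraMap_apply _ B E]
    exact IsLocalization.map_units E (⟨_, Submonoid.mem_map_of_mem _ hu⟩ : V)
  have : Algebra.FormallyUnramified (MvPolynomial (Fin n) ℂ) E := by
    refine formallyUnramified_of_isUnit_det_pderiv (S := MvPolynomial (Fin n) ℂ) (E := E) F
      (fun i => ⟨MvPolynomial.X i, by simp [hmap]⟩) (fun i => ?_)
      (hunit _ (Submonoid.mem_sup_left (Submonoid.mem_powers J))) (fun e => ?_)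
    · rw [IsScalarTower.algebraMap_apply _ B E, Ideal.Quotient.algebraMap_eq,
        Ideal.Quotient.eq_zero_iff_mem.2 (Ideal.subset_span (Set.mem_range_self i)), map_zero]
    · obtain ⟨⟨b, v⟩, h⟩ := IsLocalization.surj V e
      obtain ⟨u, hu, huv⟩ := v.2
      obtain ⟨a, rfl⟩ := Ideal.Quotient.mk_surjective b
      refine ⟨a, u, hunit u hu, ?_⟩
      rw [IsScalarTower.algebraMap_apply _ B E, IsScalarTower.algebraMap_apply _ B E a,
        Ideal.Quotient.algebraMap_eq, huv]
      exact (mul_comm _ e).trans h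
  obtain ⟨G, hG, hG0⟩ := exists_mvPolynomial_ne_zero_of_isAlgebraic (k := ℂ) (B := E)
    (fun i : Fin (n + 1) => algebraMap (MvPolynomial (Fin (n + N)) ℂ) E
      (MvPolynomial.X (Fin.castLE hle i)))
    (fun i => by
      rw [IsScalarTower.algebraMap_apply (MvPolynomial (Fin n) ℂ)
        (MvPolynomial (Fin (n + N)) ℂ) E, hmap,
        MvPolynomial.rename_X]
      rfl)
    (isAlgebraic_of_formallyUnramified_of_isUnit (fun s hs => by
      rw [IsScalarTower.algebraMap_apply (MvPolynomial (Fin n) ℂ)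
        (MvPolynomial (Fin (n + N)) ℂ) E]
      exact hunit _ (Submonoid.mem_sup_right
        (Submonoid.mem_map_of_mem _ (mem_nonZeroDivisors_of_ne_zero hs)))) _)
  have hG1 : algebraMap B E (Ideal.Quotient.mk I (MvPolynomial.rename (Fin.castLE hle) G)) = 0 := by
    rw [← hG0, ← Ideal.Quotient.algebraMap_eq, ← IsScalarTower.algebraMap_apply]
    have hren : MvPolynomial.rename (Fin.castLE hle) G = MvPolynomial.aeval
        (fun i => (MvPolynomial.X (Fin.castLE hle i) : MvPolynomial (Fin (n + N)) ℂ)) G := by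
      rw [MvPolynomial.rename_eq_aeval]
      rfl
    rw [hren]
    exact (MvPolynomial.aeval_algebraMap_apply E _ G).symm
  obtain ⟨⟨_, u, hu, rfl⟩, h⟩ := (IsLocalization.map_eq_zero_iff V E _).1 hG1
  obtain ⟨_, ⟨m, rfl⟩, _, ⟨s, hs, rfl⟩, rfl⟩ := Submonoid.mem_sup.1 hu
  refine ⟨MvPolynomial.rename Fin.castSucc s * G, J ^ m, mul_ne_zero ?_ hG, ?_, ?_⟩
  · rw [Ne, map_eq_zero_iff _ (MvPolynomial.rename_injective _ (Fin.castSucc_injective n))]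
    exact nonZeroDivisors.ne_zero hs
  · rw [map_pow]
    exact pow_ne_zero m hJ0
  · rw [← map_mul, Ideal.Quotient.eq_zero_iff_mem] at h
    have hcomp : MvPolynomial.rename (Fin.castLE hle) (MvPolynomial.rename Fin.castSucc s) =
        MvPolynomial.rename (Fin.castAdd N) s := by
      rw [MvPolynomial.rename_rename]
      rfl
    rw [map_mul, hcomp]
    convert h using 1
    simp only [hmap]
    ring

end
end

section
/- Let N ≥ n ≥ 1. Let ψ₁,…,ψ_n be holomorphic functions defined in an open disk centered at the origin in ℂ, and let φ₁,…,φ_N be an n-variable DIRE family. Assume that ψ_i(z) = z·φ_i(z·ψ₁(z),…,z·ψ_n(z)) for i = 1,…,n and all z ∈ ℂ sufficiently near the origin. Then ψ₁,…,ψ_n can be extended to a 1-variable DIRE family: there exist M ≥ n and holomorphic functions ψ_{n+1},…,ψ_M, each defined in a connected open neighborhood of the origin in ℂ, such that ψ₁,…,ψ_M is a 1-variable DIRE family. -/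
open MeasureTheory Filter
open scoped Classical

noncomputable section

/-- Chain rule for partial derivatives of a polynomial evaluated at polynomials. -/
theorem pderiv_bind₁_eq_sum {R σ τ : Type*} [CommRing R] [Fintype σ]
    (f : σ → MvPolynomial τ R) (i : τ) (p : MvPolynomial σ R) :
    MvPolynomial.pderiv i (MvPolynomial.bind₁ f p) =
      ∑ k, MvPolynomial.bind₁ f (MvPolynomial.pderiv k p) * MvPolynomial.pderiv i (f k) := by
  induction p using MvPolynomial.induction_on with
  | C a => simp
  | add p q hp hq => simp [hp, hq, add_mul, Finset.sum_add_distrib]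
  | mul_X p m hp =>
    simp only [map_mul, MvPolynomial.bind₁_X_right, Derivation.leibniz, smul_eq_mul, hp, map_add,
      MvPolynomial.pderiv_X, add_mul, Finset.sum_add_distrib, Finset.mul_sum]
    congr 1
    · rw [Finset.sum_eq_single m]
      · simp
      · intro b _ hb
        simp [Pi.single_eq_of_ne hb.symm]
      · simp
    · exact Finset.sum_congr rfl fun k _ => by ring

theorem tendsto_mul_pi_nhds_zero {ι : Type*} {ψ : ι → ℂ → ℂ}
    (hψ : ∀ i, ContinuousAt (ψ i) 0) :
    Tendsto (fun (z : ℂ) (i : ι) => z * ψ i z) (nhds 0) (nhds 0) := by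
  refine tendsto_pi_nhds.2 fun i => ?_
  simpa [ContinuousAt, Pi.mul_def] using (continuousAt_id (x := (0 : ℂ))).mul (hψ i)

/-- The polynomials at which the equations of the given family are evaluated. -/
def substPoly (n N : ℕ) : Fin (n + N) → MvPolynomial (Fin (1 + (n + N))) ℂ :=
  Fin.append
    (fun m => MvPolynomial.X 0 * MvPolynomial.X (Fin.natAdd 1 (Fin.castAdd N m)))
    (fun k => MvPolynomial.X (Fin.natAdd 1 (Fin.natAdd n k)))

/-- The equations of the extended family: `Y_i = z (W_i + c_i)` and `A_j (z Y, W) = 0`. -/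
def extendedEqs {n N : ℕ} (hnN : n ≤ N) (c : Fin n → ℂ)
    (A : Fin N → MvPolynomial (Fin (n + N)) ℂ) :
    Fin (n + N) → MvPolynomial (Fin (1 + (n + N))) ℂ :=
  Fin.append
    (fun i => MvPolynomial.X (Fin.natAdd 1 (Fin.castAdd N i)) - MvPolynomial.X 0 *
      (MvPolynomial.X (Fin.natAdd 1 (Fin.natAdd n (Fin.castLE hnN i))) + MvPolynomial.C (c i)))
    (fun j => MvPolynomial.bind₁ (substPoly n N) (A j))

theorem eval_bind₁_substPoly {n N : ℕ} (x : Fin (1 + (n + N)) → ℂ)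
    (p : MvPolynomial (Fin (n + N)) ℂ) :
    MvPolynomial.eval x (MvPolynomial.bind₁ (substPoly n N) p) =
      MvPolynomial.eval (Fin.append (fun m => x 0 * x (Fin.natAdd 1 (Fin.castAdd N m)))
        (fun k => x (Fin.natAdd 1 (Fin.natAdd n k)))) p := by
  induction p using MvPolynomial.induction_on with
  | C a => simp
  | add p q hp hq => simp [hp, hq]
  | mul_X p m hp =>
    simp only [map_mul, hp, MvPolynomial.bind₁_X_right, MvPolynomial.eval_X]
    congr 1
    refine Fin.addCases (fun i => ?_) (fun i => ?_) m <;> simp [substPoly]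

theorem eval_zero_bind₁_substPoly {n N : ℕ} (p : MvPolynomial (Fin (n + N)) ℂ) :
    MvPolynomial.eval 0 (MvPolynomial.bind₁ (substPoly n N) p) = MvPolynomial.eval 0 p := by
  rw [eval_bind₁_substPoly]
  congr 2
  ext m
  refine Fin.addCases (fun i => ?_) (fun i => ?_) m <;> simp

theorem extendedEqs_jacobian {n N : ℕ} (hnN : n ≤ N) (c : Fin n → ℂ)
    (A : Fin N → MvPolynomial (Fin (n + N)) ℂ) :
    (Matrix.of fun i j : Fin (n + N) => MvPolynomial.eval (0 : Fin (1 + (n + N)) → ℂ)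
        (MvPolynomial.pderiv (Fin.natAdd 1 j) (extendedEqs hnN c A i))).submatrix
      finSumFinEquiv finSumFinEquiv =
    Matrix.fromBlocks 1 0 0 (Matrix.of fun i j : Fin N =>
      MvPolynomial.eval (0 : Fin (n + N) → ℂ) (MvPolynomial.pderiv (Fin.natAdd n j) (A i))) := by
  have h0 : ∀ k : Fin (n + N), (0 : Fin (1 + (n + N))) ≠ Fin.natAdd 1 k := fun k h => by
    simpa [add_comm 1] using congrArg Fin.val h
  have hne : ∀ (a : Fin n) (b : Fin N), Fin.castAdd N a ≠ Fin.natAdd n b := fun a b h => by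
    have := congrArg Fin.val h
    simp only [Fin.val_castAdd, Fin.val_natAdd] at this
    omega
  ext (i | i) (j | j)
  · simp [extendedEqs, h0, Matrix.one_apply, Pi.single_apply,
      apply_ite MvPolynomial.constantCoeff]
  · simp [extendedEqs, h0, hne]
  · simp only [Matrix.submatrix_apply, Matrix.of_apply, finSumFinEquiv_apply_right,
      finSumFinEquiv_apply_left, extendedEqs, Fin.append_right, pderiv_bind₁_eq_sum]
    simp [Fin.sum_univ_add, substPoly, (hne _ _).symm]
  · simp only [Matrix.submatrix_apply, Matrix.of_apply, finSumFinEquiv_apply_right,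
      extendedEqs, Fin.append_right, pderiv_bind₁_eq_sum, map_sum, map_mul,
      eval_zero_bind₁_substPoly, Matrix.fromBlocks_apply₂₂]
    simp [Fin.sum_univ_add, substPoly, Pi.single_apply,
      apply_ite MvPolynomial.constantCoeff]

/-- **Lemma 6.8** (the decisive trick): if `ψ₁,…,ψ_n` are holomorphic near the
origin of `ℂ` and satisfy `ψ_i(z) = z·φ_i(zψ₁(z),…,zψ_n(z))` for an `n`-variable
DIRE family `φ₁,…,φ_N` (`N ≥ n`), then `ψ₁,…,ψ_n` extends to a `1`-variable DIRE
family. -/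
theorem extend_to_one_variable_dire {n N : ℕ} (hn : 0 < n) (hnN : n ≤ N)
    (r : ℝ) (hr : 0 < r) (ψ : Fin n → ℂ → ℂ)
    (hψ : ∀ i, DifferentiableOn ℂ (ψ i) (Metric.ball (0 : ℂ) r))
    (U : Fin N → Set (Fin n → ℂ)) (φ : Fin N → (Fin n → ℂ) → ℂ)
    (hφ : IsDIREFamily U φ)
    (heq : ∀ᶠ z : ℂ in nhds 0, ∀ i : Fin n,
      ψ i z = z * φ (Fin.castLE hnN i) (fun m => z * ψ m z)) :
    ∃ (M : ℕ) (hM : n ≤ M) (V : Fin M → Set (Fin 1 → ℂ))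
      (χ : Fin M → (Fin 1 → ℂ) → ℂ),
      (∀ i : Fin n, χ (Fin.castLE hM i) = fun v => ψ i (v 0)) ∧
      IsDIREFamily V χ := by
  have hsub := tendsto_mul_pi_nhds_zero fun i =>
    (hψ i).continuousOn.continuousAt (Metric.ball_mem_nhds 0 hr)
  obtain ⟨ε, hε, hmaps⟩ := Metric.eventually_nhds_iff_ball.1
    (eventually_all.2 fun j => hsub ((hφ.isOpen j).mem_nhds (hφ.mem_zero j)))
  obtain ⟨δ, hδ, hδε, hδr⟩ : ∃ δ > 0, δ ≤ ε ∧ δ ≤ r :=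
    ⟨min ε r, lt_min hε hr, min_le_left _ _, min_le_right _ _⟩
  obtain ⟨A, B, -, hA, hdet, hzero⟩ := hφ.rational
  have hψ0 : ∀ i, ψ i 0 = 0 := fun i => by simpa using heq.self_of_nhds i
  have hproj : Tendsto (fun v : Fin 1 → ℂ => v 0) (nhds 0) (nhds 0) :=
    (continuous_apply (0 : Fin 1)).tendsto 0
  have hball : ∀ v ∈ Metric.ball (0 : Fin 1 → ℂ) δ, v 0 ∈ Metric.ball (0 : ℂ) δ := by
    intro v hv
    rw [mem_ball_zero_iff] at hv ⊢
    exact (norm_le_pi_norm v 0).trans_lt hv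
  have hd0 : Differentiable ℂ fun v : Fin 1 → ℂ => v 0 := differentiable_apply 0
  have hψd : ∀ i, DifferentiableOn ℂ (fun v : Fin 1 → ℂ => ψ i (v 0)) (Metric.ball 0 δ) :=
    fun i => (hψ i).comp hd0.differentiableOn
      fun v hv => Metric.ball_subset_ball hδr (hball v hv)
  refine ⟨n + N, Nat.le_add_right n N, fun _ => Metric.ball 0 δ,
    Fin.append (fun i v => ψ i (v 0)) (fun j v => φ j (fun m => v 0 * ψ m (v 0))),
    fun i => Fin.append_left _ _ i, ?_⟩
  refine ⟨fun _ => Metric.isOpen_ball,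
    fun _ => (convex_ball _ _).isConnected (Metric.nonempty_ball.2 hδ),
    fun _ => Metric.mem_ball_self hδ, ?_, ?_⟩
  · refine Fin.addCases (fun i => ?_) (fun j => ?_)
    · simpa using hψd i
    · simp only [Fin.append_right]
      exact (hφ.holo j).comp
        (differentiableOn_pi.2 fun m => hd0.differentiableOn.mul (hψd m))
        fun v hv => hmaps _ (Metric.ball_subset_ball hδε (hball v hv)) j
  · refine ⟨extendedEqs hnN (fun i => φ (Fin.castLE hnN i) 0) A, fun _ => 1,
      by simp, ?_, ?_, ?_⟩
    · refine Fin.addCases (fun i => ?_) (fun j => ?_)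
      · simp [extendedEqs]
      · simp only [extendedEqs, Fin.append_right]
        exact (eval_zero_bind₁_substPoly _).trans (hA j)
    · simp only [map_one, div_one]
      rw [← Matrix.det_submatrix_equiv_self finSumFinEquiv, extendedEqs_jacobian,
        Matrix.det_fromBlocks_zero₁₂, Matrix.det_one, one_mul]
      intro h
      refine hdet ?_
      have := Matrix.det_mul_column (fun i => (MvPolynomial.eval 0 (B i))⁻¹)
        (Matrix.of fun i j : Fin N => MvPolynomial.eval (0 : Fin (n + N) → ℂ)
          (MvPolynomial.pderiv (Fin.natAdd n j) (A i)))
      rw [h, mul_zero] at this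
      simpa only [Matrix.of_apply, div_eq_inv_mul] using this
    · filter_upwards [hproj.eventually heq, (hsub.comp hproj).eventually hzero] with v hv hv'
      have hz : (fun _ : Fin n => (0 : ℂ)) = 0 := rfl
      have hv0 : ∀ k : Fin (1 + (n + N)) → ℂ, k 0 = k (Fin.castAdd (n + N) 0) := fun _ => rfl
      refine Fin.addCases (fun i => ?_) (fun j => ?_)
      · simp only [extendedEqs, Fin.append_left, map_sub, map_mul, map_add, MvPolynomial.eval_X,
          MvPolynomial.eval_C, Fin.append_right, hv0, Pi.zero_apply, hψ0, mul_zero, hz]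
        rw [hv i]
        ring
      · simp only [extendedEqs, Fin.append_right, eval_bind₁_substPoly, hv0, Fin.append_left,
          Pi.zero_apply, hψ0, mul_zero, hz, sub_zero]
        exact hv' j
end
end

section
/- Let λ, w, S be complex numbers with λ ≠ 0. If 2w⁴ − λw³ + 4w² − 2λw + 2 = 0 and λS = 1 + w², then 4λ²S⁴ − λ³S³ − λ²S² + λS + 1 = 0. -/
/-- Elimination of the auxiliary variable `w` (Section 3.4): if
`2w⁴ − λw³ + 4w² − 2λw + 2 = 0` and `λS = 1 + w²` with `λ ≠ 0`, then the
Stieltjes transform `S` of the limit law for the (NE+SE+SW+NW)-filtered Wigner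
matrix satisfies `4λ²S⁴ − λ³S³ − λ²S² + λS + 1 = 0`. -/
theorem filtered_wigner_quartic (lam w S : ℂ) (hlam : lam ≠ 0)
    (hw : 2 * w ^ 4 - lam * w ^ 3 + 4 * w ^ 2 - 2 * lam * w + 2 = 0)
    (hS : lam * S = 1 + w ^ 2) :
    4 * lam ^ 2 * S ^ 4 - lam ^ 3 * S ^ 3 - lam ^ 2 * S ^ 2 + lam * S + 1 = 0 := by
  have h : 2 * lam * S ^ 2 = w * (lam * S + 1) := by
    apply mul_left_cancel₀ hlam
    linear_combination hw + (2 * (lam * S + 1 + w ^ 2) - lam * w) * hS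
  linear_combination (2 * lam * S ^ 2 + w * (lam * S + 1)) * h - (lam * S + 1) ^ 2 * hS
end
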